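/- arXiv:2204.11472 — 4 statements merged into one kernel-verified Lean document; each statement's English description precedes it below -/
import Mathlib

section
/- For any measurable density ρ : ℝ → [0,1] with 0 < ∫ρ < ∞ and any natural number k ≥ 1, the k-th variational Neumann eigenvalue μ_k(ρ) := inf over (k+1)-dimensional subspaces S of {u·1_{ρ>0} : u ∈ C_c^∞(ℝ)} of the max over nonzero u ∈ S of (∫ ρ |u'|² dx)/(∫ ρ u² dx) satisfies μ_k(ρ) ≤ π² k² / (∫_ℝ ρ dx)². -/
open MeasureTheory Set ENNReal Real

/-- The indicator of a set, as a linear map on real-valued functions. -/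
noncomputable def indicatorL {α : Type*} (s : Set α) : (α → ℝ) →ₗ[ℝ] (α → ℝ) where
  toFun f := s.indicator f
  map_add' f g := by ext x; by_cases h : x ∈ s <;> simp [Set.indicator_apply, h]
  map_smul' c f := by ext x; by_cases h : x ∈ s <;> simp [Set.indicator_apply, h]

/-- The `k`-th variational Neumann eigenvalue of a density `ρ` on `ℝ`: the infimum,
over subspaces of smooth compactly supported functions whose restriction to `{ρ > 0}`
is `(k+1)`-dimensional, of the maximum of the Rayleigh quotient
`(∫ ρ u'²)/(∫ ρ u²)` over nonzero elements. -/
noncomputable def mu1 (k : ℕ) (ρ : ℝ → ℝ) : ℝ≥0∞ :=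
  ⨅ V : {V : Submodule ℝ (ℝ → ℝ) //
      (∀ u ∈ V, ContDiff ℝ (⊤ : ℕ∞) u ∧ HasCompactSupport u) ∧
      Module.finrank ℝ (V.map (indicatorL {x | 0 < ρ x})) = k + 1},
    ⨆ u : {u : ℝ → ℝ // u ∈ V.1 ∧ indicatorL {x | 0 < ρ x} u ≠ 0},
    ENNReal.ofReal ((∫ x, ρ x * (deriv u.1 x) ^ 2) / (∫ x, ρ x * (u.1 x) ^ 2))

section

open Filter Topology

/-- A density with values in `[0,1]` is the a.e. limit of smooth functions with values in
`[-1,1]`. -/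
theorem exists_smooth_tendsto_ae {ρ : ℝ → ℝ} (hρ : ∀ x, 0 ≤ ρ x ∧ ρ x ≤ 1)
    (hint : Integrable ρ) :
    ∃ r : ℕ → ℝ → ℝ, (∀ n, ContDiff ℝ (⊤ : ℕ∞) (r n)) ∧ (∀ n x, |r n x| ≤ 1) ∧
      ∀ᵐ x, Tendsto (fun n => r n x) atTop (𝓝 (ρ x)) := by
  let φ : ℕ → ContDiffBump (0 : ℝ) := fun n =>
    ⟨1 / ((n : ℝ) + 1), 2 * (1 / ((n : ℝ) + 1)), by positivity, by
      have : 0 < 1 / ((n : ℝ) + 1) := by positivity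
      linarith⟩
  refine ⟨fun n => convolution ((φ n).normed volume) ρ (ContinuousLinearMap.lsmul ℝ ℝ) volume,
    fun n => ?_, fun n x => ?_, ?_⟩
  · exact (φ n).hasCompactSupport_normed.contDiff_convolution_left _ (φ n).contDiff_normed
      hint.locallyIntegrable
  · have h := dist_convolution_le (μ := volume) (g := ρ) (f := (φ n).normed volume) (x₀ := x)
      (R := (φ n).rOut) (ε := 1 / 2) (z₀ := 1 / 2) (by norm_num)
      (φ n).support_normed_eq.subset (φ n).nonneg_normed (φ n).integral_normed
      hint.aestronglyMeasurable
      (fun y _ => by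
        rw [Real.dist_eq, abs_le]
        constructor <;> linarith [hρ y])
    rw [Real.dist_eq, abs_le] at h
    rw [abs_le]
    constructor <;> linarith [h.1, h.2]
  · refine ContDiffBump.ae_convolution_tendsto_right_of_locallyIntegrable (K := 2) ?_
      (Eventually.of_forall fun n => le_rfl) hint.locallyIntegrable
    have h := (tendsto_one_div_add_atTop_nhds_zero_nat (𝕜 := ℝ)).const_mul (2 : ℝ)
    rwa [mul_zero] at h

/-- There is a sequence of smooth cutoffs exhausting the line whose derivatives are uniformly
bounded and tend to zero. -/
theorem exists_smooth_cutoffs :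
    ∃ (χ : ℕ → ℝ → ℝ) (C : ℝ), ∀ n, ContDiff ℝ (⊤ : ℕ∞) (χ n) ∧ HasCompactSupport (χ n) ∧
      ∀ x, |χ n x| ≤ 1 ∧ |deriv (χ n) x| ≤ C ∧ Tendsto (fun n => χ n x) atTop (𝓝 1) ∧
        Tendsto (fun n => deriv (χ n) x) atTop (𝓝 0) := by
  let b : ContDiffBump (0 : ℝ) := ⟨1, 2, one_pos, one_lt_two⟩
  have hb : ContDiff ℝ (⊤ : ℕ∞) b := b.contDiff
  obtain ⟨C, hC⟩ := b.hasCompactSupport.deriv.exists_bound_of_continuous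
    (hb.continuous_deriv (by simp))
  have hd : ∀ (n : ℕ) x, deriv (fun x => b ((1 / ((n : ℝ) + 1)) * x)) x
      = 1 / ((n : ℝ) + 1) * deriv b (1 / ((n : ℝ) + 1) * x) := by
    intro n x
    exact deriv_comp_mul_left (1 / ((n : ℝ) + 1)) b x
  have hC0 : 0 ≤ C := (norm_nonneg _).trans (hC 0)
  have hlim : Tendsto (fun n : ℕ => 1 / ((n : ℝ) + 1)) atTop (𝓝 0) :=
    tendsto_one_div_add_atTop_nhds_zero_nat
  refine ⟨fun n x => b ((1 / ((n : ℝ) + 1)) * x), C, fun n => ⟨?_, ?_, fun x => ⟨?_, ?_, ?_, ?_⟩⟩⟩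
  · exact hb.comp (contDiff_const.mul contDiff_id)
  · have h0 : (1 / ((n : ℝ) + 1)) ≠ 0 := by positivity
    exact b.hasCompactSupport.comp_homeomorph (Homeomorph.mulLeft₀ _ h0)
  · rw [abs_of_nonneg b.nonneg]
    exact b.le_one
  · rw [hd, abs_mul]
    have h1 : |1 / ((n : ℝ) + 1)| ≤ 1 := by
      rw [abs_of_nonneg (by positivity), div_le_one (by positivity)]
      linarith [(Nat.cast_nonneg n : (0 : ℝ) ≤ n)]
    calc _ ≤ 1 * C := mul_le_mul h1 (hC _) (abs_nonneg _) zero_le_one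
      _ = C := one_mul C
  · have h := (hb.continuous.tendsto 0).comp (by simpa using hlim.mul_const x :
      Tendsto (fun n : ℕ => 1 / ((n : ℝ) + 1) * x) atTop (𝓝 0))
    have h1 : b 0 = 1 := b.one_of_mem_closedBall (by simp [b.rIn_pos.le])
    rwa [h1] at h
  · simp_rw [hd]
    refine squeeze_zero_norm (a := fun n : ℕ => 1 / ((n : ℝ) + 1) * C) (fun m => ?_)
      (by simpa using hlim.mul_const C)
    rw [norm_mul, Real.norm_of_nonneg (by positivity : 0 ≤ 1 / ((m : ℝ) + 1))]
    exact mul_le_mul_of_nonneg_left (hC _) (by positivity)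

theorem integrable_density_mul {ρ f : ℝ → ℝ} (hint : Integrable ρ)
    (hf : AEStronglyMeasurable f) {C : ℝ} (hC : ∀ x, |f x| ≤ C) :
    Integrable (fun x => ρ x * f x) :=
  hint.mul_bdd (c := C) hf (Eventually.of_forall hC)

theorem tendsto_integral_density_mul {ρ f : ℝ → ℝ} {g : ℕ → ℝ → ℝ} (hint : Integrable ρ)
    (hg : ∀ n, AEStronglyMeasurable (g n)) {C : ℝ} (hC : ∀ n x, |g n x| ≤ C)
    (hlim : ∀ᵐ x, Tendsto (fun n => g n x) atTop (𝓝 (f x))) :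
    Tendsto (fun n => ∫ x, ρ x * g n x) atTop (𝓝 (∫ x, ρ x * f x)) := by
  refine tendsto_integral_of_dominated_convergence (fun x => |ρ x| * C)
    (fun n => hint.aestronglyMeasurable.mul (hg n)) (hint.abs.mul_const C)
    (fun n => Eventually.of_forall fun x => ?_) ?_
  · rw [norm_mul]
    exact mul_le_mul_of_nonneg_left (hC n x) (abs_nonneg _)
  · filter_upwards [hlim] with x hx using hx.const_mul _

theorem integral_mul_sum_sq {ι : Type*} [Fintype ι] {ρ : ℝ → ℝ} {f : ι → ℝ → ℝ}
    (h : ∀ i j, Integrable fun x => ρ x * (f i x * f j x)) (c : ι → ℝ) :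
    ∫ x, ρ x * (∑ i, c i * f i x) ^ 2
      = ∑ i, ∑ j, c i * c j * ∫ x, ρ x * (f i x * f j x) := by
  have h1 : ∀ x, ρ x * (∑ i, c i * f i x) ^ 2
      = ∑ i, ∑ j, c i * c j * (ρ x * (f i x * f j x)) := by
    intro x
    rw [sq, Finset.sum_mul_sum, Finset.mul_sum]
    refine Finset.sum_congr rfl fun i _ => ?_
    rw [Finset.mul_sum]
    exact Finset.sum_congr rfl fun j _ => by ring
  simp_rw [h1]
  rw [integral_finsetSum _ fun i _ => integrable_finsetSum _ fun j _ => (h i j).const_mul _]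
  refine Finset.sum_congr rfl fun i _ => ?_
  rw [integral_finsetSum _ fun j _ => (h i j).const_mul _]
  exact Finset.sum_congr rfl fun j _ => integral_const_mul _ _

/-- A positive definite quadratic form stays positive definite under small perturbations of its
coefficients. -/
theorem eventually_quadratic_pos {ι : Type*} [Fintype ι] {D : ℕ → ι → ι → ℝ} {E : ι → ι → ℝ}
    (hD : ∀ i j, Tendsto (fun n => D n i j) atTop (𝓝 (E i j))) {δ : ℝ} (hδ : 0 < δ)
    (hE : ∀ c : ι → ℝ, δ * ∑ i, c i ^ 2 ≤ ∑ i, ∑ j, c i * c j * E i j) :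
    ∀ᶠ n in atTop, ∀ c : ι → ℝ, c ≠ 0 → 0 < ∑ i, ∑ j, c i * c j * D n i j := by
  have hlim : Tendsto (fun n => ∑ i, ∑ j, |D n i j - E i j|) atTop (𝓝 0) := by
    have : Tendsto (fun n => ∑ i, ∑ j, |D n i j - E i j|) atTop
        (𝓝 (∑ i : ι, ∑ j : ι, |E i j - E i j|)) :=
      tendsto_finsetSum _ fun i _ => tendsto_finsetSum _ fun j _ => ((hD i j).sub_const _).abs
    simpa using this
  filter_upwards [hlim.eventually (gt_mem_nhds hδ)] with n hn c hc
  have hpos : 0 < ∑ i, c i ^ 2 := by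
    obtain ⟨i, hi⟩ := Function.ne_iff.mp hc
    exact Finset.sum_pos' (fun _ _ => sq_nonneg _) ⟨i, Finset.mem_univ i, by
      have : c i ≠ 0 := hi
      positivity⟩
  have hle : ∀ i, c i ^ 2 ≤ ∑ i, c i ^ 2 := fun i =>
    Finset.single_le_sum (fun _ _ => sq_nonneg _) (Finset.mem_univ i)
  have key : ∑ i, ∑ j, c i * c j * E i j - (∑ i, c i ^ 2) * ∑ i, ∑ j, |D n i j - E i j|
      ≤ ∑ i, ∑ j, c i * c j * D n i j := by
    rw [Finset.mul_sum, ← Finset.sum_sub_distrib]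
    refine Finset.sum_le_sum fun i _ => ?_
    rw [Finset.mul_sum, ← Finset.sum_sub_distrib]
    refine Finset.sum_le_sum fun j _ => ?_
    have h1 : |c i * c j| ≤ ∑ i, c i ^ 2 := by
      rw [abs_le]
      constructor <;> nlinarith [hle i, hle j, sq_nonneg (c i + c j), sq_nonneg (c i - c j)]
    have h2 : |c i * c j * (D n i j - E i j)| ≤ (∑ i, c i ^ 2) * |D n i j - E i j| := by
      rw [abs_mul]
      exact mul_le_mul_of_nonneg_right h1 (abs_nonneg _)
    linarith [(abs_le.mp h2).1]
  nlinarith [hE c]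

theorem exists_smooth_primitive_tendsto {ρ : ℝ → ℝ} (hρ : ∀ x, 0 ≤ ρ x ∧ ρ x ≤ 1)
    (hint : Integrable ρ) (a : ℝ) :
    ∃ r R : ℕ → ℝ → ℝ, (∀ n, ContDiff ℝ (⊤ : ℕ∞) (R n)) ∧ (∀ n, Continuous (r n)) ∧
      (∀ n x, HasDerivAt (R n) (r n x) x) ∧ (∀ n x, |r n x| ≤ 1) ∧
      (∀ᵐ x, Tendsto (fun n => r n x) atTop (𝓝 (ρ x))) ∧
      ∀ x, Tendsto (fun n => R n x) atTop (𝓝 (a + ∫ t in (0)..x, ρ t)) := by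
  obtain ⟨r, hr, hr1, hlim⟩ := exists_smooth_tendsto_ae hρ hint
  have hd : ∀ n x, HasDerivAt (fun x => a + ∫ t in (0)..x, r n t) (r n x) x := fun n x =>
    ((hr n).continuous.integral_hasStrictDerivAt 0 x).hasDerivAt.const_add a
  refine ⟨r, fun n x => a + ∫ t in (0)..x, r n t, fun n => ?_, fun n => (hr n).continuous, hd,
    hr1, hlim, fun x => ?_⟩
  · rw [contDiff_infty_iff_deriv]
    refine ⟨fun x => (hd n x).differentiableAt, ?_⟩
    rw [show deriv (fun x => a + ∫ t in (0)..x, r n t) = r n from funext fun x => (hd n x).deriv]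
    exact hr n
  · refine Tendsto.const_add a ?_
    refine intervalIntegral.tendsto_integral_filter_of_dominated_convergence (fun _ => 1)
      (Eventually.of_forall fun n => (hr n).continuous.aestronglyMeasurable)
      (Eventually.of_forall fun n => Eventually.of_forall fun t _ => hr1 n t)
      intervalIntegrable_const ?_
    filter_upwards [hlim] with t ht _ using ht

/-- Change of variables along the primitive of a density with values in `[0,1]`. -/
theorem intervalIntegral_mul_comp_primitive {ρ : ℝ → ℝ} (hρ : ∀ x, 0 ≤ ρ x ∧ ρ x ≤ 1)
    (hint : Integrable ρ) (a : ℝ) {H h : ℝ → ℝ} (hH : ∀ y, HasDerivAt H (h y) y)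
    (hh : Continuous h) {C : ℝ} (hC : ∀ y, |h y| ≤ C) (p q : ℝ) :
    ∫ x in p..q, ρ x * h (a + ∫ t in (0)..x, ρ t)
      = H (a + ∫ t in (0)..q, ρ t) - H (a + ∫ t in (0)..p, ρ t) := by
  obtain ⟨r, R, hRs, hr, hR, hr1, hlim, hRlim⟩ := exists_smooth_primitive_tendsto hρ hint a
  have hHc : Continuous H := continuous_iff_continuousAt.2 fun y => (hH y).continuousAt
  have hc : ∀ n, Continuous fun x => r n x * h (R n x) := fun n =>
    (hr n).mul (hh.comp (hRs n).continuous)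
  have h1 : ∀ n, ∫ x in p..q, r n x * h (R n x) = H (R n q) - H (R n p) := by
    intro n
    refine intervalIntegral.integral_eq_sub_of_hasDerivAt (f := fun x => H (R n x))
      (fun x _ => ?_) ((hc n).intervalIntegrable p q)
    rw [mul_comm]
    exact (hH (R n x)).comp x (hR n x)
  have h2 : Tendsto (fun n => ∫ x in p..q, r n x * h (R n x)) atTop
      (𝓝 (∫ x in p..q, ρ x * h (a + ∫ t in (0)..x, ρ t))) := by
    refine intervalIntegral.tendsto_integral_filter_of_dominated_convergence (fun _ => C)
      (Eventually.of_forall fun n => (hc n).aestronglyMeasurable)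
      (Eventually.of_forall fun n => Eventually.of_forall fun x _ => ?_)
      intervalIntegrable_const ?_
    · rw [norm_mul]
      calc _ ≤ 1 * C := mul_le_mul (hr1 n x) (hC _) (abs_nonneg _) zero_le_one
        _ = C := one_mul C
    · filter_upwards [hlim] with x hx _
      exact hx.mul ((hh.tendsto _).comp (hRlim x))
  simp_rw [h1] at h2
  exact tendsto_nhds_unique h2
    (((hHc.tendsto _).comp (hRlim q)).sub ((hHc.tendsto _).comp (hRlim p)))

theorem continuous_primitive {ρ : ℝ → ℝ} (hint : Integrable ρ) (a : ℝ) :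
    Continuous fun x => a + ∫ t in (0)..x, ρ t :=
  continuous_const.add
    (intervalIntegral.continuous_primitive (fun _ _ => hint.intervalIntegrable) 0)

/-- The distribution function of a density pushes it forward to Lebesgue measure. -/
theorem integral_mul_comp_distribution {ρ : ℝ → ℝ} (hρ : ∀ x, 0 ≤ ρ x ∧ ρ x ≤ 1)
    (hint : Integrable ρ) {H h : ℝ → ℝ} (hH : ∀ y, HasDerivAt H (h y) y)
    (hh : Continuous h) {C : ℝ} (hC : ∀ y, |h y| ≤ C) :
    ∫ x, ρ x * h ((∫ t in Iic 0, ρ t) + ∫ t in (0)..x, ρ t) = H (∫ x, ρ x) - H 0 := by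
  have hHc : Continuous H := continuous_iff_continuousAt.2 fun y => (hH y).continuousAt
  have htop : Tendsto (fun n : ℕ => (n : ℝ)) atTop atTop := tendsto_natCast_atTop_atTop
  have hbot : Tendsto (fun n : ℕ => -(n : ℝ)) atTop atBot := tendsto_neg_atTop_atBot.comp htop
  have h1 := intervalIntegral_tendsto_integral (integrable_density_mul hint
    (hh.comp (continuous_primitive hint (∫ t in Iic 0, ρ t))).aestronglyMeasurable
    fun x => hC _) hbot htop
  simp only [Function.comp_apply] at h1
  simp_rw [intervalIntegral_mul_comp_primitive hρ hint _ hH hh hC] at h1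
  have hq : Tendsto (fun n : ℕ => (∫ t in Iic 0, ρ t) + ∫ t in (0)..(n : ℝ), ρ t) atTop
      (𝓝 (∫ x, ρ x)) := by
    have h := (intervalIntegral_tendsto_integral_Ioi 0 hint.integrableOn htop).const_add
      (∫ t in Iic 0, ρ t)
    rwa [intervalIntegral.integral_Iic_add_Ioi hint.integrableOn hint.integrableOn] at h
  have hp : Tendsto (fun n : ℕ => (∫ t in Iic 0, ρ t) + ∫ t in (0)..(-(n : ℝ)), ρ t) atTop
      (𝓝 0) := by
    have h := (intervalIntegral_tendsto_integral_Iic 0 hint.integrableOn hbot).const_sub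
      (∫ t in Iic 0, ρ t)
    rw [sub_self] at h
    refine h.congr fun n => ?_
    rw [intervalIntegral.integral_symm]
    ring
  exact tendsto_nhds_unique h1 (((hHc.tendsto _).comp hq).sub ((hHc.tendsto _).comp hp))

/-- The angle `π F / M`, where `F` is the distribution function of `ρ` and `M` its mass. -/
noncomputable def massAngle (ρ : ℝ → ℝ) (x : ℝ) : ℝ :=
  π / (∫ x, ρ x) * ((∫ t in Iic 0, ρ t) + ∫ t in (0)..x, ρ t)

theorem continuous_massAngle {ρ : ℝ → ℝ} (hint : Integrable ρ) : Continuous (massAngle ρ) :=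
  continuous_const.mul (continuous_primitive hint _)

theorem integral_mul_cos_massAngle {ρ : ℝ → ℝ} (hρ : ∀ x, 0 ≤ ρ x ∧ ρ x ≤ 1)
    (hint : Integrable ρ) (hpos : 0 < ∫ x, ρ x) (m : ℤ) :
    ∫ x, ρ x * cos (m * massAngle ρ x) = if m = 0 then ∫ x, ρ x else 0 := by
  split_ifs with hm
  · simp [hm]
  · set M := ∫ x, ρ x with hM
    have hm' : (m : ℝ) ≠ 0 := by exact_mod_cast hm
    have hne : (m : ℝ) * (π / M) ≠ 0 := mul_ne_zero hm' (div_pos pi_pos hpos).ne'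
    have h := integral_mul_comp_distribution hρ hint
      (H := fun y => sin (m * (π / M) * y) / (m * (π / M)))
      (h := fun y => cos (m * (π / M) * y)) (C := 1)
      (fun y => by
        have h1 := (((hasDerivAt_id y).const_mul (m * (π / M))).sin).div_const (m * (π / M))
        simpa [mul_div_assoc, hne] using h1)
      (by fun_prop) (fun y => abs_cos_le_one _)
    have h2 : (m : ℝ) * (π / M) * M = m * π := by field_simp
    simp only [massAngle, ← hM, ← mul_assoc]
    rw [← hM] at h
    simp only [h2, sin_int_mul_pi] at h
    simpa [← mul_assoc] using h

theorem integral_mul_cos_mul_cos {ρ : ℝ → ℝ} (hρ : ∀ x, 0 ≤ ρ x ∧ ρ x ≤ 1)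
    (hint : Integrable ρ) (hpos : 0 < ∫ x, ρ x) (i j : ℕ) :
    ∫ x, ρ x * (cos (i * massAngle ρ x) * cos (j * massAngle ρ x))
      = (∫ x, ρ x) / 2 * ((if i = j then 1 else 0) + if i + j = 0 then 1 else 0) := by
  have hi : ∀ m : ℤ, Integrable fun x => ρ x * cos (m * massAngle ρ x) := fun m =>
    integrable_density_mul hint (continuous_cos.comp
      (continuous_const.mul (continuous_massAngle hint))).aestronglyMeasurable
      fun x => abs_cos_le_one _
  have h : ∀ x, ρ x * (cos (i * massAngle ρ x) * cos (j * massAngle ρ x))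
      = 1 / 2 * (ρ x * cos (((i - j : ℤ) : ℝ) * massAngle ρ x)
        + ρ x * cos (((i + j : ℤ) : ℝ) * massAngle ρ x)) := by
    intro x
    push_cast
    rw [sub_mul, add_mul, cos_sub, cos_add]
    ring
  simp_rw [h]
  rw [integral_const_mul, integral_add (hi _) (hi _), integral_mul_cos_massAngle hρ hint hpos,
    integral_mul_cos_massAngle hρ hint hpos]
  have e1 : (i - j : ℤ) = 0 ↔ i = j := by omega
  have e2 : (i + j : ℤ) = 0 ↔ i + j = 0 := by omega
  simp only [e1, e2]
  split_ifs <;> ring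

theorem integral_mul_sin_mul_sin {ρ : ℝ → ℝ} (hρ : ∀ x, 0 ≤ ρ x ∧ ρ x ≤ 1)
    (hint : Integrable ρ) (hpos : 0 < ∫ x, ρ x) (i j : ℕ) :
    ∫ x, ρ x * (sin (i * massAngle ρ x) * sin (j * massAngle ρ x))
      = (∫ x, ρ x) / 2 * ((if i = j then 1 else 0) - if i + j = 0 then 1 else 0) := by
  have hi : ∀ m : ℤ, Integrable fun x => ρ x * cos (m * massAngle ρ x) := fun m =>
    integrable_density_mul hint (continuous_cos.comp
      (continuous_const.mul (continuous_massAngle hint))).aestronglyMeasurable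
      fun x => abs_cos_le_one _
  have h : ∀ x, ρ x * (sin (i * massAngle ρ x) * sin (j * massAngle ρ x))
      = 1 / 2 * (ρ x * cos (((i - j : ℤ) : ℝ) * massAngle ρ x)
        - ρ x * cos (((i + j : ℤ) : ℝ) * massAngle ρ x)) := by
    intro x
    push_cast
    rw [sub_mul, add_mul, cos_sub, cos_add]
    ring
  simp_rw [h]
  rw [integral_const_mul, integral_sub (hi _) (hi _), integral_mul_cos_massAngle hρ hint hpos,
    integral_mul_cos_massAngle hρ hint hpos]
  have e1 : (i - j : ℤ) = 0 ↔ i = j := by omega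
  have e2 : (i + j : ℤ) = 0 ↔ i + j = 0 := by omega
  simp only [e1, e2]
  split_ifs <;> ring

theorem sum_sum_mul_ite_eq {m : ℕ} (c : Fin m → ℝ) :
    ∑ i, ∑ j, c i * c j * (if (i : ℕ) = j then 1 else 0) = ∑ i, c i ^ 2 := by
  refine Finset.sum_congr rfl fun i _ => ?_
  simp [Fin.val_inj, sq]

theorem sum_sum_mul_ite_add_eq_zero {m : ℕ} (c : Fin m → ℝ) :
    ∑ i, ∑ j, c i * c j * (if (i : ℕ) + j = 0 then 1 else 0)
      = (∑ i, c i * if (i : ℕ) = 0 then 1 else 0) ^ 2 := by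
  rw [sq, Finset.sum_mul_sum]
  refine Finset.sum_congr rfl fun i _ => Finset.sum_congr rfl fun j _ => ?_
  by_cases hi : (i : ℕ) = 0 <;> by_cases hj : (j : ℕ) = 0 <;> simp [hi, hj]

theorem le_integral_mul_sum_cos_sq {ρ : ℝ → ℝ} (hρ : ∀ x, 0 ≤ ρ x ∧ ρ x ≤ 1)
    (hint : Integrable ρ) (hpos : 0 < ∫ x, ρ x) {m : ℕ} (c : Fin m → ℝ) :
    (∫ x, ρ x) / 2 * ∑ i, c i ^ 2
      ≤ ∫ x, ρ x * (∑ i : Fin m, c i * cos ((i : ℕ) * massAngle ρ x)) ^ 2 := by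
  have hθ := continuous_massAngle hint
  rw [integral_mul_sum_sq fun i j => integrable_density_mul (C := 1) hint
    (Continuous.aestronglyMeasurable (by fun_prop)) fun x => by
      rw [abs_mul]
      exact mul_le_one₀ (abs_cos_le_one _) (abs_nonneg _) (abs_cos_le_one _)]
  have h : ∀ i j : Fin m, c i * c j * (∫ x, ρ x * (cos ((i : ℕ) * massAngle ρ x)
      * cos ((j : ℕ) * massAngle ρ x)))
      = (∫ x, ρ x) / 2 * (c i * c j * (if (i : ℕ) = j then 1 else 0))
        + (∫ x, ρ x) / 2 * (c i * c j * if (i : ℕ) + j = 0 then 1 else 0) := fun i j => by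
    rw [integral_mul_cos_mul_cos hρ hint hpos]
    ring
  simp_rw [h, Finset.sum_add_distrib, ← Finset.mul_sum, sum_sum_mul_ite_eq,
    sum_sum_mul_ite_add_eq_zero]
  nlinarith [sq_nonneg (∑ i, c i * if (i : ℕ) = 0 then 1 else 0)]

theorem integral_mul_sum_sin_sq_le {ρ : ℝ → ℝ} (hρ : ∀ x, 0 ≤ ρ x ∧ ρ x ≤ 1)
    (hint : Integrable ρ) (hpos : 0 < ∫ x, ρ x) {m : ℕ} (c : Fin m → ℝ) :
    ∫ x, ρ x * (∑ i : Fin m, c i * sin ((i : ℕ) * massAngle ρ x)) ^ 2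
      ≤ (∫ x, ρ x) / 2 * ∑ i, c i ^ 2 := by
  have hθ := continuous_massAngle hint
  rw [integral_mul_sum_sq fun i j => integrable_density_mul (C := 1) hint
    (Continuous.aestronglyMeasurable (by fun_prop)) fun x => by
      rw [abs_mul]
      exact mul_le_one₀ (abs_sin_le_one _) (abs_nonneg _) (abs_sin_le_one _)]
  have h : ∀ i j : Fin m, c i * c j * (∫ x, ρ x * (sin ((i : ℕ) * massAngle ρ x)
      * sin ((j : ℕ) * massAngle ρ x)))
      = (∫ x, ρ x) / 2 * (c i * c j * (if (i : ℕ) = j then 1 else 0))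
        - (∫ x, ρ x) / 2 * (c i * c j * if (i : ℕ) + j = 0 then 1 else 0) := fun i j => by
    rw [integral_mul_sin_mul_sin hρ hint hpos]
    ring
  simp_rw [h, Finset.sum_sub_distrib, ← Finset.mul_sum, sum_sum_mul_ite_eq,
    sum_sum_mul_ite_add_eq_zero]
  nlinarith [sq_nonneg (∑ i, c i * if (i : ℕ) = 0 then 1 else 0)]

/-- Smooth compactly supported approximations of the functions `cos (j π F / M)`, where `F` is the
distribution function of `ρ` and `M` its mass, together with their derivatives. -/
theorem exists_approx_cos_massAngle {ρ : ℝ → ℝ} (hρ : ∀ x, 0 ≤ ρ x ∧ ρ x ≤ 1)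
    (hint : Integrable ρ) (hpos : 0 < ∫ x, ρ x) :
    ∃ v : ℕ → ℕ → ℝ → ℝ, (∀ n j, ContDiff ℝ (⊤ : ℕ∞) (v n j) ∧ HasCompactSupport (v n j)) ∧
      (∀ n j x, |v n j x| ≤ 1) ∧ (∀ j, ∃ C, ∀ n x, |deriv (v n j) x| ≤ C) ∧
      (∀ j x, Tendsto (fun n => v n j x) atTop (𝓝 (cos (j * massAngle ρ x)))) ∧
      ∀ j, ∀ᵐ x, Tendsto (fun n => deriv (v n j) x) atTop
        (𝓝 (-(j * (π / ∫ x, ρ x)) * sin (j * massAngle ρ x) * ρ x)) := by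
  obtain ⟨r, R, hRs, hr, hR, hr1, hlim, hRlim⟩ :=
    exists_smooth_primitive_tendsto hρ hint (∫ t in Iic 0, ρ t)
  obtain ⟨χ, C, hχ⟩ := exists_smooth_cutoffs
  set ω := π / ∫ x, ρ x with hω
  have hω0 : 0 < ω := div_pos pi_pos hpos
  have hθ : ∀ x, Tendsto (fun n => ω * R n x) atTop (𝓝 (massAngle ρ x)) := fun x =>
    (hRlim x).const_mul ω
  have hd : ∀ n (j : ℕ) x, HasDerivAt (fun x => χ n x * cos (j * (ω * R n x)))
      (deriv (χ n) x * cos (j * (ω * R n x))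
        + χ n x * (-(j * ω) * sin (j * (ω * R n x)) * r n x)) x := by
    intro n j x
    have h1 : HasDerivAt (χ n) (deriv (χ n) x) x :=
      ((hχ n).1.differentiable (by simp) x).hasDerivAt
    convert! h1.mul ((((hR n x).const_mul ω).const_mul (j : ℝ)).cos) using 1
    ring
  refine ⟨fun n j x => χ n x * cos (j * (ω * R n x)), fun n j => ⟨?_, (hχ n).2.1.mul_right⟩,
    fun n j x => ?_, fun j => ⟨C + j * ω, fun n x => ?_⟩, fun j x => ?_, fun j => ?_⟩
  · exact (hχ n).1.mul (contDiff_const.mul (contDiff_const.mul (hRs n))).cos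
  · rw [abs_mul]
    exact mul_le_one₀ ((hχ n).2.2 x).1 (abs_nonneg _) (abs_cos_le_one _)
  · rw [(hd n j x).deriv]
    obtain ⟨h1, h2, -⟩ := (hχ n).2.2 x
    refine (abs_add_le _ _).trans (add_le_add ?_ ?_)
    · rw [abs_mul]
      exact (mul_le_of_le_one_right (abs_nonneg _) (abs_cos_le_one _)).trans h2
    · rw [abs_mul, abs_mul, abs_mul, abs_neg, abs_of_nonneg (by positivity : 0 ≤ j * ω)]
      calc _ ≤ 1 * (j * ω * 1 * 1) := by
            gcongr
            · exact abs_sin_le_one _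
            · exact hr1 n x
        _ = j * ω := by ring
  · have h := ((hχ 0).2.2 x).2.2.1.mul ((continuous_cos.tendsto _).comp ((hθ x).const_mul (j : ℝ)))
    simpa using h
  · filter_upwards [hlim] with x hx
    simp_rw [fun n => (hd n j x).deriv]
    have h1 := ((hχ 0).2.2 x).2.2.2.mul
      ((continuous_cos.tendsto _).comp ((hθ x).const_mul (j : ℝ)))
    have h2 := ((hχ 0).2.2 x).2.2.1.mul
      ((((continuous_sin.tendsto _).comp ((hθ x).const_mul (j : ℝ))).const_mul (-(j * ω))).mul hx)
    simpa using h1.add h2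

/-- The functions `cos (j π F / M)`, `j ≤ k`, satisfy the Rayleigh quotient bound. -/
theorem le_rayleigh_form_cos {ρ : ℝ → ℝ} (hρ : ∀ x, 0 ≤ ρ x ∧ ρ x ≤ 1)
    (hint : Integrable ρ) (hpos : 0 < ∫ x, ρ x) (k : ℕ) {ε : ℝ}
    (hε : 0 < ε) (c : Fin (k + 1) → ℝ) :
    ε * ((∫ x, ρ x) / 2) * ∑ i, c i ^ 2
      ≤ (π ^ 2 * (k : ℝ) ^ 2 / (∫ x, ρ x) ^ 2 + ε)
          * (∫ x, ρ x * (∑ i, c i * cos ((i : ℕ) * massAngle ρ x)) ^ 2)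
        - ∫ x, ρ x * (∑ i, c i *
          (-((i : ℕ) * (π / ∫ x, ρ x)) * sin ((i : ℕ) * massAngle ρ x) * ρ x)) ^ 2 := by
  set M := ∫ x, ρ x with hM
  set ω := π / M with hω
  have hθ := continuous_massAngle hint
  have hcos := le_integral_mul_sum_cos_sq hρ hint hpos c
  have hsin := integral_mul_sum_sin_sq_le hρ hint hpos fun i => c i * -((i : ℕ) * ω)
  rw [← hM] at hcos hsin
  have hmono : ∫ x, ρ x * (∑ i, c i * (-((i : ℕ) * ω) * sin ((i : ℕ) * massAngle ρ x) * ρ x)) ^ 2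
      ≤ ∫ x, ρ x * (∑ i, c i * -((i : ℕ) * ω) * sin ((i : ℕ) * massAngle ρ x)) ^ 2 := by
    refine integral_mono_of_nonneg
      (Eventually.of_forall fun x => mul_nonneg (hρ x).1 (sq_nonneg _))
      (integrable_density_mul (C := (∑ i : Fin (k + 1), |c i * -((i : ℕ) * ω)|) ^ 2) hint
        (Continuous.aestronglyMeasurable (by fun_prop)) fun x => ?_)
      (Eventually.of_forall fun x => ?_)
    · rw [abs_pow]
      refine pow_le_pow_left₀ (abs_nonneg _) ((Finset.abs_sum_le_sum_abs _ _).trans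
        (Finset.sum_le_sum fun i _ => ?_)) 2
      rw [abs_mul]
      exact mul_le_of_le_one_right (abs_nonneg _) (abs_sin_le_one _)
    · dsimp only
      simp_rw [← mul_assoc, ← Finset.sum_mul]
      rw [mul_pow]
      refine mul_le_mul_of_nonneg_left (mul_le_of_le_one_right (sq_nonneg _) ?_) (hρ x).1
      exact pow_le_one₀ (hρ x).1 (hρ x).2
  have hsum : ∑ i : Fin (k + 1), (c i * -((i : ℕ) * ω)) ^ 2 ≤ k ^ 2 * ω ^ 2 * ∑ i, c i ^ 2 := by
    rw [Finset.mul_sum]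
    refine Finset.sum_le_sum fun i _ => ?_
    have hi : ((i : ℕ) : ℝ) ^ 2 ≤ k ^ 2 := by
      gcongr
      omega
    calc _ = ((i : ℕ) : ℝ) ^ 2 * (ω ^ 2 * c i ^ 2) := by ring
      _ ≤ k ^ 2 * (ω ^ 2 * c i ^ 2) := by gcongr
      _ = _ := by ring
  have hlam : π ^ 2 * (k : ℝ) ^ 2 / M ^ 2 = k ^ 2 * ω ^ 2 := by
    rw [hω]
    ring
  rw [hlam]
  have h1 := mul_le_mul_of_nonneg_left hcos (by positivity : 0 ≤ (k : ℝ) ^ 2 * ω ^ 2 + ε)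
  have h2 := mul_le_mul_of_nonneg_left hsum (by positivity : 0 ≤ M / 2)
  linarith

theorem exists_test_functions {ρ : ℝ → ℝ} (hρ : ∀ x, 0 ≤ ρ x ∧ ρ x ≤ 1)
    (hmeas : Measurable ρ) (hint : Integrable ρ) (hpos : 0 < ∫ x, ρ x) (k : ℕ) {ε : ℝ}
    (hε : 0 < ε) :
    ∃ v : Fin (k + 1) → ℝ → ℝ, (∀ i, ContDiff ℝ (⊤ : ℕ∞) (v i) ∧ HasCompactSupport (v i)) ∧
      ∀ c : Fin (k + 1) → ℝ, c ≠ 0 →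
        ∫ x, ρ x * deriv (∑ i, c i • v i) x ^ 2
          < (π ^ 2 * (k : ℝ) ^ 2 / (∫ x, ρ x) ^ 2 + ε)
            * ∫ x, ρ x * (∑ i, c i • v i) x ^ 2 := by
  obtain ⟨v, hv, hv1, hdv, hvlim, hdvlim⟩ := exists_approx_cos_massAngle hρ hint hpos
  choose C hC using hdv
  set L := π ^ 2 * (k : ℝ) ^ 2 / (∫ x, ρ x) ^ 2 + ε with hL
  have hθ := continuous_massAngle hint
  have hvc : ∀ n j, Continuous (v n j) := fun n j => (hv n j).1.continuous
  have hdc : ∀ n j, Continuous (deriv (v n j)) := fun n j => (hv n j).1.continuous_deriv (by simp)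
  have bv : ∀ n i j x, |v n i x * v n j x| ≤ 1 := fun n i j x => by
    rw [abs_mul]
    exact mul_le_one₀ (hv1 n i x) (abs_nonneg _) (hv1 n j x)
  have bd : ∀ i j n x, |deriv (v n i) x * deriv (v n j) x| ≤ C i * C j := fun i j n x => by
    rw [abs_mul]
    exact mul_le_mul (hC i n x) (hC j n x) (abs_nonneg _) ((abs_nonneg _).trans (hC i n x))
  have lv : ∀ i j, Tendsto (fun n => ∫ x, ρ x * (v n i x * v n j x)) atTop
      (𝓝 (∫ x, ρ x * (cos (i * massAngle ρ x) * cos (j * massAngle ρ x)))) := fun i j =>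
    tendsto_integral_density_mul hint
      (fun n => ((hvc n i).mul (hvc n j)).aestronglyMeasurable) (fun n x => bv n i j x)
      (Eventually.of_forall fun x => (hvlim i x).mul (hvlim j x))
  have ld : ∀ i j, Tendsto (fun n => ∫ x, ρ x * (deriv (v n i) x * deriv (v n j) x)) atTop
      (𝓝 (∫ x, ρ x * ((-(i * (π / ∫ x, ρ x)) * sin (i * massAngle ρ x) * ρ x)
        * (-(j * (π / ∫ x, ρ x)) * sin (j * massAngle ρ x) * ρ x)))) := fun i j =>
    tendsto_integral_density_mul hint
      (fun n => ((hdc n i).mul (hdc n j)).aestronglyMeasurable) (bd i j)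
      (by filter_upwards [hdvlim i, hdvlim j] with x h1 h2 using h1.mul h2)
  have hvi : ∀ n i j, Integrable fun x => ρ x * (v n i x * v n j x) := fun n i j =>
    integrable_density_mul hint ((hvc n i).mul (hvc n j)).aestronglyMeasurable (bv n i j)
  have hdi : ∀ n i j, Integrable fun x => ρ x * (deriv (v n i) x * deriv (v n j) x) :=
    fun n i j => integrable_density_mul hint ((hdc n i).mul (hdc n j)).aestronglyMeasurable
      (bd i j n)
  have hci : ∀ i j : ℕ, Integrable fun x =>
      ρ x * (cos (i * massAngle ρ x) * cos (j * massAngle ρ x)) := fun i j =>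
    integrable_density_mul (C := 1) hint (Continuous.aestronglyMeasurable (by fun_prop))
      fun x => by
        rw [abs_mul]
        exact mul_le_one₀ (abs_cos_le_one _) (abs_nonneg _) (abs_cos_le_one _)
  have hsi : ∀ i j : ℕ, Integrable fun x =>
      ρ x * ((-(i * (π / ∫ x, ρ x)) * sin (i * massAngle ρ x) * ρ x)
        * (-(j * (π / ∫ x, ρ x)) * sin (j * massAngle ρ x) * ρ x)) := fun i j => by
    have hs : ∀ (j : ℕ) x, |-(j * (π / ∫ x, ρ x)) * sin (j * massAngle ρ x) * ρ x|
        ≤ |-(j * (π / ∫ x, ρ x))| := fun j x => by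
      rw [abs_mul, abs_mul, mul_assoc]
      refine mul_le_of_le_one_right (abs_nonneg _)
        (mul_le_one₀ (abs_sin_le_one _) (abs_nonneg _) ?_)
      rw [abs_of_nonneg (hρ x).1]
      exact (hρ x).2
    have hsm : ∀ j : ℕ, Measurable fun x =>
        -(j * (π / ∫ x, ρ x)) * sin (j * massAngle ρ x) * ρ x := fun j =>
      (Continuous.measurable (by fun_prop)).mul hmeas
    exact integrable_density_mul hint ((hsm i).mul (hsm j)).aestronglyMeasurable fun x => by
      rw [abs_mul]
      exact mul_le_mul (hs i x) (hs j x) (abs_nonneg _) (abs_nonneg _)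
  have hform : ∀ (c : Fin (k + 1) → ℝ) (A B : Fin (k + 1) → Fin (k + 1) → ℝ),
      ∑ i, ∑ j, c i * c j * (L * A i j - B i j)
        = L * ∑ i, ∑ j, c i * c j * A i j - ∑ i, ∑ j, c i * c j * B i j := fun c A B => by
    simp_rw [Finset.mul_sum, ← Finset.sum_sub_distrib]
    exact Finset.sum_congr rfl fun i _ => Finset.sum_congr rfl fun j _ => by ring
  obtain ⟨n, hn⟩ := (eventually_quadratic_pos (ι := Fin (k + 1))
    (fun i j => ((lv i j).const_mul L).sub (ld i j))
    (mul_pos hε (half_pos hpos)) fun c => by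
      rw [hform, ← integral_mul_sum_sq fun i j : Fin (k + 1) => hci i j,
        ← integral_mul_sum_sq fun i j : Fin (k + 1) => hsi i j]
      exact le_rayleigh_form_cos hρ hint hpos k hε c).exists
  refine ⟨fun i => v n i, fun i => hv n i, fun c hc => ?_⟩
  have h := hn c hc
  rw [hform, ← integral_mul_sum_sq fun i j : Fin (k + 1) => hvi n i j,
    ← integral_mul_sum_sq fun i j : Fin (k + 1) => hdi n i j, sub_pos] at h
  have hsum : (∑ i : Fin (k + 1), c i • v n i) = fun x => ∑ i : Fin (k + 1), c i * v n i x := by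
    ext x
    simp
  have hderiv : ∀ x, deriv (fun x => ∑ i : Fin (k + 1), c i * v n i x) x
      = ∑ i : Fin (k + 1), c i * deriv (v n i) x := fun x =>
    (HasDerivAt.fun_sum fun (i : Fin (k + 1)) _ =>
      (((hv n i).1.differentiable (by simp) x).hasDerivAt.const_mul (c i))).deriv
  rw [hsum]
  simpa only [hderiv] using h

end

/-- Pólya conjecture for densities in dimension one: for any measurable density
`ρ : ℝ → [0,1]` with finite positive mass and any `k ≥ 1`,
`μ_k(ρ) ≤ π² k² / (∫ ρ)²`. -/
theorem stmt_0 (ρ : ℝ → ℝ) (hmeas : Measurable ρ) (hρ01 : ∀ x, 0 ≤ ρ x ∧ ρ x ≤ 1)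
    (hint : Integrable ρ) (hpos : 0 < ∫ x, ρ x) (k : ℕ) (hk : 1 ≤ k) :
    mu1 k ρ ≤ ENNReal.ofReal (π ^ 2 * (k : ℝ) ^ 2 / (∫ x, ρ x) ^ 2) := by
  set L := π ^ 2 * (k : ℝ) ^ 2 / (∫ x, ρ x) ^ 2 with hL
  have hL0 : 0 ≤ L := by positivity
  refine ENNReal.le_of_forall_pos_le_add fun ε hε _ => ?_
  rw [← ENNReal.ofReal_coe_nnreal, ← ENNReal.ofReal_add hL0 ε.coe_nonneg]
  obtain ⟨v, hv, hlt⟩ := exists_test_functions hρ01 hmeas hint hpos k (ε := ε) hε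
  have hli : LinearIndependent ℝ (indicatorL {x | 0 < ρ x} ∘ v) := by
    rw [Fintype.linearIndependent_iff']
    refine LinearMap.ker_eq_bot'.2 fun c hc => ?_
    by_contra hne
    have hzero : indicatorL {x | 0 < ρ x} (∑ i, c i • v i) = 0 := by
      simpa [LinearMap.lsum_apply] using hc
    have h0 : ∀ x, ρ x * (∑ i, c i • v i) x ^ 2 = 0 := fun x => by
      rcases (hρ01 x).1.eq_or_lt with hx | hx
      · rw [← hx, zero_mul]
      · have hmem : x ∈ {x | 0 < ρ x} := hx
        have h := congrFun hzero x
        change Set.indicator _ _ x = 0 at h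
        rw [Set.indicator_of_mem hmem] at h
        rw [h]
        ring
    have h := hlt c hne
    simp only [h0, integral_zero, mul_zero] at h
    exact h.not_ge (integral_nonneg fun x => mul_nonneg (hρ01 x).1 (sq_nonneg _))
  have hV : (∀ u ∈ Submodule.span ℝ (Set.range v),
        ContDiff ℝ (⊤ : ℕ∞) u ∧ HasCompactSupport u) ∧
      Module.finrank ℝ ((Submodule.span ℝ (Set.range v)).map (indicatorL {x | 0 < ρ x}))
        = k + 1 := by
    constructor
    · intro u hu
      induction hu using Submodule.span_induction with
      | mem u hu => obtain ⟨i, rfl⟩ := hu; exact hv i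
      | zero => exact ⟨contDiff_const, HasCompactSupport.zero⟩
      | add f g _ _ hf hg => exact ⟨hf.1.add hg.1, hf.2.add hg.2⟩
      | smul a f _ hf => exact ⟨hf.1.const_smul a, hf.2.smul_left (f := fun _ => a)⟩
    · rw [Submodule.map_span, ← Set.range_comp, finrank_span_eq_card hli, Fintype.card_fin]
  refine (iInf_le _ ⟨_, hV⟩).trans (iSup_le fun ⟨u, hu, _⟩ => ENNReal.ofReal_le_ofReal ?_)
  obtain ⟨c, rfl⟩ := Submodule.mem_span_range_iff_exists_fun ℝ |>.1 hu
  refine div_le_of_le_mul₀ (integral_nonneg fun x => mul_nonneg (hρ01 x).1 (sq_nonneg _))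
    (add_nonneg hL0 ε.coe_nonneg) ?_
  rcases eq_or_ne c 0 with rfl | hc
  · simp
  · exact (hlt c hc).le
end

section
/- Let ρ be the characteristic function of a disjoint union of k open intervals in ℝ, each of length m/k. Then the k-th variational Neumann eigenvalue satisfies μ_k(ρ) = π² k² / m². -/
open MeasureTheory Set ENNReal Real

/-- The Wirtinger inequality on `[0, l]` for functions vanishing at `0`, with a strictly
suboptimal constant. -/
theorem sq_mul_integral_sq_le_of_lt {F : ℝ → ℝ} (hF : ContDiff ℝ 1 F) (h0 : F 0 = 0) {l a : ℝ}
    (hl : 0 < l) (ha : 0 ≤ a) (hal : a * l < π / 2) :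
    a ^ 2 * ∫ x in (0 : ℝ)..l, F x ^ 2 ≤ ∫ x in (0 : ℝ)..l, deriv F x ^ 2 := by
  have hcF : Continuous F := hF.continuous
  have hcF' : Continuous (deriv F) := hF.continuous_deriv le_rfl
  have hcos : ∀ x ∈ Icc 0 l, cos (a * (l - x)) ≠ 0 := by
    intro x hx
    refine (cos_pos_of_mem_Ioo ⟨?_, ?_⟩).ne'
    · have : 0 ≤ a * (l - x) := mul_nonneg ha (by linarith [hx.2])
      linarith [pi_pos]
    · nlinarith [hx.1]
  set G' : ℝ → ℝ := fun x => a * ((1 / cos (a * (l - x)) ^ 2) * (-a)) * F x ^ 2 +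
    a * tan (a * (l - x)) * (2 * F x * deriv F x) with hG'
  have hG : ∀ x ∈ uIcc 0 l,
      HasDerivAt (fun x => a * tan (a * (l - x)) * F x ^ 2) (G' x) x := by
    intro x hx
    rw [uIcc_of_le hl.le] at hx
    have h1 : HasDerivAt (fun x => a * (l - x)) (-a) x := by
      simpa using ((hasDerivAt_id x).const_sub l).const_mul a
    have h2 := ((hasDerivAt_tan (hcos x hx)).comp x h1).const_mul a
    have h3 := ((hF.differentiable one_ne_zero).differentiableAt (x := x)).hasDerivAt.pow 2
    have h4 := h2.mul h3
    convert! h4 using 1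
    simp [hG']
  have hcG' : ContinuousOn G' (Icc 0 l) := by
    have htan : ContinuousOn (fun x => tan (a * (l - x))) (Icc 0 l) := by
      refine continuousOn_tan.comp (by fun_prop) fun x hx => hcos x hx
    have hinv : ContinuousOn (fun x => 1 / cos (a * (l - x)) ^ 2) (Icc 0 l) :=
      continuousOn_const.div (by fun_prop) fun x hx => pow_ne_zero 2 (hcos x hx)
    exact ((continuousOn_const.mul (hinv.mul continuousOn_const)).mul
      (hcF.pow 2).continuousOn).add ((continuousOn_const.mul htan).mul
        (by fun_prop))
  have hiG' : IntervalIntegrable G' volume 0 l :=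
    ContinuousOn.intervalIntegrable (by rwa [uIcc_of_le hl.le])
  have hint : ∫ x in (0 : ℝ)..l, G' x = 0 := by
    rw [intervalIntegral.integral_eq_sub_of_hasDerivAt hG hiG']
    simp [h0]
  have hiF : IntervalIntegrable (fun x => a ^ 2 * F x ^ 2) volume 0 l :=
    Continuous.intervalIntegrable (by fun_prop) _ _
  have hmono : ∫ x in (0 : ℝ)..l, (a ^ 2 * F x ^ 2 + G' x) ≤ ∫ x in (0 : ℝ)..l, deriv F x ^ 2 := by
    refine intervalIntegral.integral_mono_on hl.le (hiF.add hiG')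
      (Continuous.intervalIntegrable (by fun_prop) _ _) fun x hx => ?_
    have ht : 1 / cos (a * (l - x)) ^ 2 = 1 + tan (a * (l - x)) ^ 2 := by
      rw [tan_eq_sin_div_cos]
      have := hcos x hx
      field_simp
      exact (cos_sq_add_sin_sq _).symm
    simp only [hG', ht]
    nlinarith [sq_nonneg (deriv F x - a * tan (a * (l - x)) * F x)]
  rw [intervalIntegral.integral_add hiF hiG', hint, intervalIntegral.integral_const_mul] at hmono
  simpa using hmono

/-- The sharp Wirtinger inequality on `[0, l]` for functions vanishing at `0`. -/
theorem sq_mul_integral_sq_le {F : ℝ → ℝ} (hF : ContDiff ℝ 1 F) (h0 : F 0 = 0) {l : ℝ}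
    (hl : 0 < l) :
    (π / (2 * l)) ^ 2 * ∫ x in (0 : ℝ)..l, F x ^ 2 ≤ ∫ x in (0 : ℝ)..l, deriv F x ^ 2 := by
  have hpos : 0 < π / (2 * l) := by positivity
  have hlim : Filter.Tendsto (fun a : ℝ => a ^ 2 * ∫ x in (0 : ℝ)..l, F x ^ 2)
      (nhdsWithin (π / (2 * l)) (Iio (π / (2 * l))))
      (nhds ((π / (2 * l)) ^ 2 * ∫ x in (0 : ℝ)..l, F x ^ 2)) :=
    (Continuous.tendsto (by fun_prop) _).mono_left nhdsWithin_le_nhds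
  refine le_of_tendsto hlim ?_
  filter_upwards [Ioo_mem_nhdsLT hpos] with a ha
  refine sq_mul_integral_sq_le_of_lt hF h0 hl ha.1.le ?_
  have := mul_lt_mul_of_pos_right ha.2 hl
  rwa [show π / (2 * l) * l = π / 2 by field_simp] at this

/-- The sharp Wirtinger inequality for functions vanishing at the midpoint of an interval. -/
theorem sq_mul_integral_sq_le_of_midpoint {u : ℝ → ℝ} (hu : ContDiff ℝ 1 u) {c L : ℝ}
    (hL : 0 < L) (h0 : u (c + L / 2) = 0) :
    (π / L) ^ 2 * ∫ x in c..(c + L), u x ^ 2 ≤ ∫ x in c..(c + L), deriv u x ^ 2 := by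
  have hcu : Continuous u := hu.continuous
  have hcu' : Continuous (deriv u) := hu.continuous_deriv le_rfl
  have hl : 0 < L / 2 := by positivity
  have hd1 : ∀ x, deriv (fun x => u (c + L / 2 + x)) x = deriv u (c + L / 2 + x) :=
    fun x => deriv_comp_const_add (f := u) _ _
  have hd2 : ∀ x, deriv (fun x => u (c + L / 2 - x)) x = -deriv u (c + L / 2 - x) :=
    fun x => deriv_comp_const_sub (f := u) _ _
  have h1 := sq_mul_integral_sq_le (F := fun x => u (c + L / 2 + x)) (by fun_prop)
    (by simpa using h0) hl
  have h2 := sq_mul_integral_sq_le (F := fun x => u (c + L / 2 - x)) (by fun_prop)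
    (by simpa using h0) hl
  simp only [hd1, hd2, neg_sq] at h1 h2
  rw [intervalIntegral.integral_comp_add_left (fun x => u x ^ 2),
    intervalIntegral.integral_comp_add_left (fun x => deriv u x ^ 2)] at h1
  rw [intervalIntegral.integral_comp_sub_left (fun x => u x ^ 2),
    intervalIntegral.integral_comp_sub_left (fun x => deriv u x ^ 2)] at h2
  rw [show 2 * (L / 2) = L by ring, show c + L / 2 + 0 = c + L / 2 by ring,
    show c + L / 2 + L / 2 = c + L by ring] at h1
  rw [show 2 * (L / 2) = L by ring, show c + L / 2 - 0 = c + L / 2 by ring,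
    show c + L / 2 - L / 2 = c by ring] at h2
  rw [← intervalIntegral.integral_add_adjacent_intervals (a := c) (b := c + L / 2) (c := c + L)
      (f := fun x => u x ^ 2) (Continuous.intervalIntegrable (by fun_prop) _ _)
      (Continuous.intervalIntegrable (by fun_prop) _ _),
    ← intervalIntegral.integral_add_adjacent_intervals (a := c) (b := c + L / 2) (c := c + L)
      (f := fun x => deriv u x ^ 2) (Continuous.intervalIntegrable (by fun_prop) _ _)
      (Continuous.intervalIntegrable (by fun_prop) _ _)]
  linarith

/-- Integration against the indicator of a finite disjoint union of intervals. -/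
theorem integral_indicator_iUnion_Ioo {ι : Type*} [Fintype ι] {c : ι → ℝ} {L : ℝ} (hL : 0 < L)
    (hdisj : Pairwise fun i j => Disjoint (Ioo (c i) (c i + L)) (Ioo (c j) (c j + L)))
    {g : ℝ → ℝ} (hg : Continuous g) :
    ∫ x, (⋃ i, Ioo (c i) (c i + L)).indicator 1 x * g x =
      ∑ i, ∫ x in (c i)..(c i + L), g x := by
  have hmeas : MeasurableSet (⋃ i, Ioo (c i) (c i + L)) :=
    MeasurableSet.iUnion fun i => measurableSet_Ioo
  have : (fun x => (⋃ i, Ioo (c i) (c i + L)).indicator 1 x * g x) =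
      (⋃ i, Ioo (c i) (c i + L)).indicator g := by
    ext x
    by_cases hx : x ∈ ⋃ i, Ioo (c i) (c i + L)
    · simp only [indicator_of_mem hx, Pi.one_apply, one_mul]
    · simp only [indicator_of_notMem hx, zero_mul]
  rw [this, integral_indicator hmeas, integral_iUnion_fintype (fun i => measurableSet_Ioo) hdisj
    fun i => (hg.integrableOn_Icc (a := c i) (b := c i + L)).mono_set Ioo_subset_Icc_self]
  refine Finset.sum_congr rfl fun i _ => ?_
  rw [intervalIntegral.integral_of_le (by linarith), integral_Ioc_eq_integral_Ioo]

/-- A smooth compactly supported cutoff separating a compact set from a closed set. -/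
theorem exists_contDiff_hasCompactSupport_eq_one {K T : Set ℝ} (hK : IsCompact K)
    (hT : IsClosed T) (hKT : Disjoint T K) :
    ∃ χ : ℝ → ℝ, ContDiff ℝ (⊤ : ℕ∞) χ ∧ HasCompactSupport χ ∧ (∀ x ∈ K, χ x = 1) ∧
      ∀ x ∈ T, χ x = 0 := by
  obtain ⟨R, hR⟩ := hK.isBounded.subset_ball 0
  have hd : Disjoint (T ∪ (Metric.ball 0 R)ᶜ) K :=
    hKT.union_left (disjoint_compl_left_iff_subset.2 hR)
  obtain ⟨f, hf0, hf1, -⟩ := exists_contMDiffMap_zero_one_of_isClosed (n := (⊤ : ℕ∞))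
    (modelWithCornersSelf ℝ ℝ)
    (hT.union Metric.isOpen_ball.isClosed_compl) hK.isClosed hd
  refine ⟨f, f.contMDiff.contDiff, ?_, fun x hx => hf1 hx, fun x hx => hf0 (Or.inl hx)⟩
  exact HasCompactSupport.intro (isCompact_closedBall 0 R) fun x hx =>
    hf0 (Or.inr fun h => hx (Metric.ball_subset_closedBall h))

/-- The function `s ↦ s exp (-δ / s)`, extended by zero to `s ≤ 0`: a smooth approximation of the
positive part. -/
noncomputable def smoothPosPart (δ s : ℝ) : ℝ := s * expNegInvGlue (s / δ)

theorem contDiff_smoothPosPart (δ : ℝ) : ContDiff ℝ (⊤ : ℕ∞) (smoothPosPart δ) :=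
  contDiff_id.mul (expNegInvGlue.contDiff.comp (contDiff_id.div_const δ))

theorem smoothPosPart_of_nonpos {δ s : ℝ} (hδ : 0 < δ) (hs : s ≤ 0) : smoothPosPart δ s = 0 := by
  rw [smoothPosPart, expNegInvGlue.zero_of_nonpos (div_nonpos_of_nonpos_of_nonneg hs hδ.le),
    mul_zero]

theorem smoothPosPart_of_pos {δ s : ℝ} (hδ : 0 < δ) (hs : 0 < s) :
    smoothPosPart δ s = s * exp (-(δ / s)) := by
  rw [smoothPosPart, expNegInvGlue, if_neg (not_le.2 (div_pos hs hδ)), inv_div]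

theorem smoothPosPart_pos {δ s : ℝ} (hδ : 0 < δ) (hs : 0 < s) : 0 < smoothPosPart δ s := by
  rw [smoothPosPart_of_pos hδ hs]; positivity

theorem sub_le_smoothPosPart {δ s : ℝ} (hδ : 0 < δ) (hs : 0 < s) :
    s - δ ≤ smoothPosPart δ s := by
  rw [smoothPosPart_of_pos hδ hs]
  have h := add_one_le_exp (-(δ / s))
  calc s - δ = s * (-(δ / s) + 1) := by field_simp; ring
    _ ≤ _ := by gcongr

theorem sq_deriv_smoothPosPart_le {δ s : ℝ} (hδ : 0 < δ) (hs : 0 < s) :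
    deriv (smoothPosPart δ) s ^ 2 ≤ 1 := by
  have heq : smoothPosPart δ =ᶠ[nhds s] fun t => t * exp (-(δ / t)) := by
    filter_upwards [Ioi_mem_nhds hs] with t ht using smoothPosPart_of_pos hδ ht
  have h1 : HasDerivAt (fun t => -(δ / t)) (δ / s ^ 2) s := by
    convert! ((hasDerivAt_inv hs.ne').const_mul (-δ)) using 1
    · ext t; simp [div_eq_mul_inv]
    · field_simp
  have h2 : HasDerivAt (fun t => t * exp (-(δ / t))) (exp (-(δ / s)) * (1 + δ / s)) s := by
    convert! (hasDerivAt_id s).mul h1.exp using 1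
    simp only [id]
    field_simp
  rw [heq.deriv_eq, h2.deriv]
  have h3 : exp (-(δ / s)) * (1 + δ / s) ≤ 1 := by
    have h := add_one_le_exp (δ / s)
    rw [exp_neg]
    rw [inv_mul_le_iff₀ (exp_pos _)]
    linarith
  have h4 : 0 ≤ exp (-(δ / s)) * (1 + δ / s) := by positivity
  exact pow_le_one₀ h4 h3

theorem sin_pi_div_mul_pos {L x : ℝ} (hx : x ∈ Ioo 0 L) : 0 < sin (π / L * x) := by
  have hL : 0 < L := hx.1.trans hx.2
  refine sin_pos_of_pos_of_lt_pi (mul_pos (by positivity) hx.1) ?_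
  calc π / L * x < π / L * L := by gcongr; exact hx.2
    _ = π := by field_simp

theorem integral_sin_pi_div_sq {L : ℝ} (hL : 0 < L) :
    ∫ x in (0 : ℝ)..L, sin (π / L * x) ^ 2 = L / 2 := by
  have h : π / L ≠ 0 := by positivity
  rw [intervalIntegral.integral_comp_mul_left (fun x => sin x ^ 2) h, integral_sin_sq]
  rw [div_mul_cancel₀ _ hL.ne']
  simp
  field_simp

theorem integral_cos_pi_div_sq {L : ℝ} (hL : 0 < L) :
    ∫ x in (0 : ℝ)..L, cos (π / L * x) ^ 2 = L / 2 := by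
  have h : π / L ≠ 0 := by positivity
  rw [intervalIntegral.integral_comp_mul_left (fun x => cos x ^ 2) h, integral_cos_sq]
  rw [div_mul_cancel₀ _ hL.ne']
  simp
  field_simp

/-- A smooth function supported in `[0, L]`, symmetric about the midpoint, whose Rayleigh quotient
is arbitrarily close to the first Dirichlet eigenvalue. -/
theorem exists_symmetric_rayleigh_le {L C : ℝ} (hL : 0 < L) (hC : (π / L) ^ 2 < C) :
    ∃ φ : ℝ → ℝ, ContDiff ℝ (⊤ : ℕ∞) φ ∧ (∀ x ∉ Ioo 0 L, φ x = 0) ∧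
      (∀ x, φ (L - x) = φ x) ∧ 0 < φ (L / 2) ∧
      ∫ x in (0 : ℝ)..L, deriv φ x ^ 2 ≤ C * ∫ x in (0 : ℝ)..L, φ x ^ 2 := by
  have hC0 : 0 < C := lt_of_le_of_lt (sq_nonneg _) hC
  set ω := π / L with hω
  have hωL : ω * L = π := by rw [hω]; field_simp
  have hω0 : 0 < ω := by positivity
  obtain ⟨δ, hδ, hδC⟩ : ∃ δ : ℝ, 0 < δ ∧ ω ^ 2 = C * (1 - 4 * δ) := by
    refine ⟨(1 - ω ^ 2 / C) / 4, ?_, by field_simp; ring⟩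
    have : ω ^ 2 / C < 1 := (div_lt_one hC0).2 hC
    linarith
  obtain ⟨χ, hχ, -, hχ1, hχ0⟩ := exists_contDiff_hasCompactSupport_eq_one
    (K := Icc 0 L) (T := (Ioo (-L) (2 * L))ᶜ) isCompact_Icc isOpen_Ioo.isClosed_compl
    (disjoint_compl_left_iff_subset.2 fun x hx => ⟨by linarith [hx.1], by linarith [hx.2]⟩)
  set φ : ℝ → ℝ := fun x => χ x * smoothPosPart δ (sin (ω * x)) with hφ
  have hsmooth : ContDiff ℝ (⊤ : ℕ∞) φ :=
    hχ.mul ((contDiff_smoothPosPart δ).comp (contDiff_sin.comp (contDiff_const.mul contDiff_id)))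
  have hin : ∀ x ∈ Icc 0 L, φ x = smoothPosPart δ (sin (ω * x)) := by
    intro x hx; simp only [hφ, hχ1 x hx, one_mul]
  have hout : ∀ x ∉ Ioo 0 L, φ x = 0 := by
    intro x hx
    by_cases hx' : x ∈ Ioo (-L) (2 * L)
    · have : sin (ω * x) ≤ 0 := by
        rcases le_or_gt x 0 with h | h
        · refine sin_nonpos_of_nonpos_of_neg_pi_le (by nlinarith) ?_
          nlinarith [hx'.1]
        · have hxL : L ≤ x := not_lt.1 fun h' => hx ⟨h, h'⟩
          rw [← neg_nonneg, ← sin_sub_pi]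
          refine sin_nonneg_of_nonneg_of_le_pi ?_ ?_
          · nlinarith
          · nlinarith [hx'.2]
      simp only [hφ, smoothPosPart_of_nonpos hδ this, mul_zero]
    · simp only [hφ, hχ0 x hx', zero_mul]
  refine ⟨φ, hsmooth, hout, fun x => ?_, ?_, ?_⟩
  · by_cases hx : x ∈ Ioo 0 L
    · rw [hin x (Ioo_subset_Icc_self hx), hin (L - x) ⟨by linarith [hx.2], by linarith [hx.1]⟩,
        mul_sub, hωL, sin_pi_sub]
    · rw [hout x hx, hout]
      exact fun h => hx ⟨by linarith [h.2], by linarith [h.1]⟩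
  · have hmid : L / 2 ∈ Ioo 0 L := ⟨by linarith, by linarith⟩
    rw [hin _ (Ioo_subset_Icc_self hmid)]
    exact smoothPosPart_pos hδ (sin_pi_div_mul_pos hmid)
  · have hup : ∫ x in (0 : ℝ)..L, deriv φ x ^ 2 ≤
        ∫ x in (0 : ℝ)..L, ω ^ 2 * cos (ω * x) ^ 2 := by
      have hc : Continuous (deriv φ) := hsmooth.continuous_deriv (by simp)
      refine intervalIntegral.integral_mono_on_of_le_Ioo hL.le
        (Continuous.intervalIntegrable (by fun_prop) _ _)
        (Continuous.intervalIntegrable (by fun_prop) _ _) fun x hx => ?_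
      have heq : φ =ᶠ[nhds x] fun t => smoothPosPart δ (sin (ω * t)) := by
        filter_upwards [Icc_mem_nhds hx.1 hx.2] with t ht using hin t ht
      have h1 : HasDerivAt (fun t => sin (ω * t)) (cos (ω * x) * ω) x := by
        simpa using ((hasDerivAt_id x).const_mul ω).sin
      have h2 : HasDerivAt (smoothPosPart δ) _ (sin (ω * x)) :=
        (((contDiff_smoothPosPart δ).differentiable (by simp)) _).hasDerivAt
      have h3 : HasDerivAt (fun t => smoothPosPart δ (sin (ω * t)))
          (deriv (smoothPosPart δ) (sin (ω * x)) * (cos (ω * x) * ω)) x := by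
        simpa only [Function.comp_def] using h2.comp x h1
      rw [heq.deriv_eq, h3.deriv, mul_pow, mul_pow,
        mul_comm (cos _ ^ 2)]
      exact mul_le_of_le_one_left (by positivity)
        (sq_deriv_smoothPosPart_le hδ (sin_pi_div_mul_pos hx))
    have hlow : ∫ x in (0 : ℝ)..L, (sin (ω * x) ^ 2 - 2 * δ) ≤ ∫ x in (0 : ℝ)..L, φ x ^ 2 := by
      have hc : Continuous φ := hsmooth.continuous
      refine intervalIntegral.integral_mono_on_of_le_Ioo hL.le
        (Continuous.intervalIntegrable (by fun_prop) _ _)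
        (Continuous.intervalIntegrable (by fun_prop) _ _) fun x hx => ?_
      rw [hin x (Ioo_subset_Icc_self hx)]
      have hs := sin_pi_div_mul_pos hx
      have hle := sub_le_smoothPosPart hδ hs
      have hp := smoothPosPart_pos hδ hs
      have h1 := sin_le_one (π / L * x)
      rw [← hω] at *
      nlinarith [mul_nonneg hs.le (sub_nonneg.2 hle), mul_nonneg hδ.le (sub_nonneg.2 h1),
        sq_nonneg (smoothPosPart δ (sin (ω * x)) - sin (ω * x))]
    rw [intervalIntegral.integral_const_mul, integral_cos_pi_div_sq hL] at hup
    rw [intervalIntegral.integral_sub (Continuous.intervalIntegrable (by fun_prop) _ _)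
      (Continuous.intervalIntegrable (by fun_prop) _ _), integral_sin_pi_div_sq hL] at hlow
    simp only [intervalIntegral.integral_const, smul_eq_mul, sub_zero] at hlow
    calc _ ≤ _ := hup
      _ = C * (L / 2 - L * (2 * δ)) := by rw [hδC]; ring
      _ ≤ _ := by gcongr

/-- An antisymmetric cosine and a symmetric function are orthogonal, both in `L²` and in the
Dirichlet form, so that a bound on the Rayleigh quotients passes to their span. -/
theorem rayleigh_add_cos_le {L C : ℝ} (hL : 0 < L) (hC : (π / L) ^ 2 ≤ C) {φ : ℝ → ℝ}
    (hφ : ContDiff ℝ 1 φ) (hsymm : ∀ x, φ (L - x) = φ x)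
    (hle : ∫ x in (0 : ℝ)..L, deriv φ x ^ 2 ≤ C * ∫ x in (0 : ℝ)..L, φ x ^ 2) (a b : ℝ) :
    ∫ x in (0 : ℝ)..L, (a * deriv φ x - b * (π / L * sin (π / L * x))) ^ 2 ≤
      C * ∫ x in (0 : ℝ)..L, (a * φ x + b * cos (π / L * x)) ^ 2 := by
  have hωL : π / L * L = π := by field_simp
  have hc : Continuous φ := hφ.continuous
  have hc' : Continuous (deriv φ) := hφ.continuous_deriv le_rfl
  have hanti : ∀ x, deriv φ (L - x) = -deriv φ x := by
    intro x
    have h : deriv (fun x => φ (L - x)) x = -deriv φ (L - x) := deriv_comp_const_sub (f := φ) _ _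
    rw [funext hsymm] at h
    linarith
  have hzero : ∀ g : ℝ → ℝ, (∀ x, g (L - x) = -g x) → ∫ x in (0 : ℝ)..L, g x = 0 := by
    intro g hg
    have h := intervalIntegral.integral_comp_sub_left (a := 0) (b := L) g L
    simp only [hg, intervalIntegral.integral_neg, sub_self, sub_zero] at h
    linarith
  have h1 : ∫ x in (0 : ℝ)..L, φ x * cos (π / L * x) = 0 := hzero _ fun x => by
    rw [hsymm, mul_sub, hωL, cos_pi_sub]; ring
  have h2 : ∫ x in (0 : ℝ)..L, deriv φ x * sin (π / L * x) = 0 := hzero _ fun x => by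
    rw [hanti, mul_sub, hωL, sin_pi_sub]; ring
  have hadd : ∀ f g h : ℝ → ℝ, Continuous f → Continuous g → Continuous h → ∀ p q r : ℝ,
      ∫ x in (0 : ℝ)..L, (p * f x + q * g x + r * h x) = p * (∫ x in (0 : ℝ)..L, f x) +
        q * (∫ x in (0 : ℝ)..L, g x) + r * ∫ x in (0 : ℝ)..L, h x := by
    intro f g h hf hg hh p q r
    rw [intervalIntegral.integral_add (Continuous.intervalIntegrable (by fun_prop) _ _)
        (Continuous.intervalIntegrable (by fun_prop) _ _),
      intervalIntegral.integral_add (Continuous.intervalIntegrable (by fun_prop) _ _)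
        (Continuous.intervalIntegrable (by fun_prop) _ _)]
    simp only [intervalIntegral.integral_const_mul]
  have hadd : ∀ f g h : ℝ → ℝ, Continuous f → Continuous g → Continuous h → ∀ p q r : ℝ,
      ∫ x in (0 : ℝ)..L, (p * f x + q * g x + r * h x) = p * (∫ x in (0 : ℝ)..L, f x) +
        q * (∫ x in (0 : ℝ)..L, g x) + r * ∫ x in (0 : ℝ)..L, h x := by
    intro f g h hf hg hh p q r
    rw [intervalIntegral.integral_add (Continuous.intervalIntegrable (by fun_prop) _ _)
        (Continuous.intervalIntegrable (by fun_prop) _ _),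
      intervalIntegral.integral_add (Continuous.intervalIntegrable (by fun_prop) _ _)
        (Continuous.intervalIntegrable (by fun_prop) _ _)]
    simp only [intervalIntegral.integral_const_mul]
  have e1 : ∫ x in (0 : ℝ)..L, (a * deriv φ x - b * (π / L * sin (π / L * x))) ^ 2 =
      a ^ 2 * (∫ x in (0 : ℝ)..L, deriv φ x ^ 2) + b ^ 2 * (π / L) ^ 2 * (L / 2) := by
    have h := hadd (fun x => deriv φ x ^ 2) (fun x => sin (π / L * x) ^ 2)
      (fun x => deriv φ x * sin (π / L * x)) (by fun_prop) (by fun_prop) (by fun_prop)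
      (a ^ 2) (b ^ 2 * (π / L) ^ 2) (-2 * a * b * (π / L))
    rw [h2, integral_sin_pi_div_sq hL, mul_zero, add_zero] at h
    rw [← h]
    congr 1; ext x; ring
  have e2 : ∫ x in (0 : ℝ)..L, (a * φ x + b * cos (π / L * x)) ^ 2 =
      a ^ 2 * (∫ x in (0 : ℝ)..L, φ x ^ 2) + b ^ 2 * (L / 2) := by
    have h := hadd (fun x => φ x ^ 2) (fun x => cos (π / L * x) ^ 2)
      (fun x => φ x * cos (π / L * x)) (by fun_prop) (by fun_prop) (by fun_prop)
      (a ^ 2) (b ^ 2) (2 * a * b)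
    rw [h1, integral_cos_pi_div_sq hL, mul_zero, add_zero] at h
    rw [← h]
    congr 1; ext x; ring
  rw [e1, e2]
  have h3 := mul_le_mul_of_nonneg_left hle (sq_nonneg a)
  have h4 := mul_le_mul_of_nonneg_right hC (by positivity : 0 ≤ b ^ 2 * (L / 2))
  linarith

theorem add_le_or_add_le_of_disjoint_Ioo {a b L : ℝ}
    (h : Disjoint (Ioo a (a + L)) (Ioo b (b + L))) : a + L ≤ b ∨ b + L ≤ a := by
  rw [Ioo_disjoint_Ioo] at h
  rcases le_total a b with hab | hab
  · rw [min_eq_left (by linarith), max_eq_right hab] at h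
    exact Or.inl h
  · rw [min_eq_right (by linarith), max_eq_left hab] at h
    exact Or.inr h

/-- A smooth compactly supported function which on every interval of the family is a multiple of
the first nonconstant Neumann eigenfunction, and which does not vanish on the `i₀`-th interval. -/
theorem exists_contDiff_eq_cos {ι : Type*} [Finite ι] {c : ι → ℝ} {L : ℝ} (hL : 0 < L)
    (hdisj : Pairwise fun i j => Disjoint (Ioo (c i) (c i + L)) (Ioo (c j) (c j + L))) (i₀ : ι) :
    ∃ ψ : ℝ → ℝ, ContDiff ℝ (⊤ : ℕ∞) ψ ∧ HasCompactSupport ψ ∧ ∃ σ : ι → ℝ, σ i₀ = 1 ∧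
      ∀ j, ∀ x ∈ Ioo (c j) (c j + L), ψ x = σ j * cos (π / L * (x - c j)) := by
  classical
  set P : ι → Prop := fun j => ∃ z : ℤ, c j = c i₀ + z * L
  have hKT : Disjoint (⋃ j ∈ {j | ¬P j}, Icc (c j) (c j + L))
      (⋃ j ∈ {j | P j}, Icc (c j) (c j + L)) := by
    simp only [disjoint_iUnion_left, disjoint_iUnion_right, mem_ofPred_eq]
    rintro j ⟨z, hz⟩ i hi
    refine Set.disjoint_left.2 fun x hx hx' => hi ?_
    rcases eq_or_ne i j with rfl | hij
    · exact ⟨z, hz⟩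
    rcases add_le_or_add_le_of_disjoint_Ioo (hdisj hij) with h | h
    · refine ⟨z - 1, ?_⟩
      push_cast
      linarith [hx.1, hx.2, hx'.1, hx'.2]
    · refine ⟨z + 1, ?_⟩
      push_cast
      linarith [hx.1, hx.2, hx'.1, hx'.2]
  obtain ⟨χ, hχ, hχc, hχ1, hχ0⟩ := exists_contDiff_hasCompactSupport_eq_one
    ((toFinite {j | P j}).isCompact_biUnion fun j _ => isCompact_Icc)
    ((toFinite {j | ¬P j}).isClosed_biUnion fun j _ => isClosed_Icc) hKT
  refine ⟨fun x => χ x * cos (π / L * (x - c i₀)), hχ.mul (by fun_prop), hχc.mul_right,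
    fun j => if h : P j then (-1) ^ h.choose else 0, ?_, fun j x hx => ?_⟩
  · have h : P i₀ := ⟨0, by simp⟩
    have hz : h.choose = 0 := by
      have := h.choose_spec
      rw [left_eq_add, mul_eq_zero, or_iff_left hL.ne'] at this
      exact_mod_cast this
    simp only [dif_pos h, hz, zpow_zero]
  · by_cases h : P j
    · have hx1 : χ x = 1 := hχ1 x (mem_biUnion (x := j) h (Ioo_subset_Icc_self hx))
      simp only [dif_pos h, hx1, one_mul]
      have hz := h.choose_spec
      rw [← cos_add_int_mul_pi]
      congr 1
      generalize h.choose = z at hz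
      rw [hz]
      field_simp
      ring
    · have hx0 : χ x = 0 := hχ0 x (mem_biUnion (x := j) h (Ioo_subset_Icc_self hx))
      simp only [dif_neg h, hx0, zero_mul]

theorem intervalIntegral_congr_Ioo {f g : ℝ → ℝ} {a b : ℝ} (hab : a ≤ b)
    (h : ∀ x ∈ Ioo a b, f x = g x) : ∫ x in a..b, f x = ∫ x in a..b, g x := by
  rw [intervalIntegral.integral_of_le hab, intervalIntegral.integral_of_le hab,
    integral_Ioc_eq_integral_Ioo, integral_Ioc_eq_integral_Ioo]
  exact setIntegral_congr_fun measurableSet_Ioo h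

theorem setOf_indicator_one_pos (S : Set ℝ) : {x | 0 < S.indicator (1 : ℝ → ℝ) x} = S := by
  ext x
  by_cases hx : x ∈ S <;> simp [hx]

/-- The combinations `∑ i, a i φ(· - c i) + b ψ` of translates of `φ` and of `ψ`. -/
noncomputable def translateComb {ι : Type*} [Fintype ι] (c : ι → ℝ) (φ ψ : ℝ → ℝ) :
    ((ι → ℝ) × ℝ) →ₗ[ℝ] (ℝ → ℝ) where
  toFun p x := ∑ i, p.1 i * φ (x - c i) + p.2 * ψ x
  map_add' p q := by
    ext x
    simp only [Prod.fst_add, Prod.snd_add, Pi.add_apply, add_mul, Finset.sum_add_distrib]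
    ring
  map_smul' r p := by
    ext x
    simp only [Prod.smul_fst, Prod.smul_snd, Pi.smul_apply, smul_eq_mul, RingHom.id_apply,
      mul_add, Finset.mul_sum, mul_assoc]

/-- On disjoint intervals of length `L`, bumps on the intervals together with one cosine give
`mu1 k` at most any number above the first Neumann eigenvalue of a single interval. -/
theorem mu1_indicator_le {k : ℕ} (hk : 1 ≤ k) {L C : ℝ} (hL : 0 < L) {c : Fin k → ℝ}
    (hdisj : Pairwise fun i j => Disjoint (Ioo (c i) (c i + L)) (Ioo (c j) (c j + L)))
    (hC : (π / L) ^ 2 < C) :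
    mu1 k ((⋃ i, Ioo (c i) (c i + L)).indicator 1) ≤ ENNReal.ofReal C := by
  have hC0 : 0 ≤ C := (sq_nonneg _).trans hC.le
  obtain ⟨φ, hφ, hφ0, hsymm, hmid, hφle⟩ := exists_symmetric_rayleigh_le hL hC
  obtain ⟨ψ, hψ, hψc, σ, hσ, hψσ⟩ := exists_contDiff_eq_cos hL hdisj ⟨0, hk⟩
  have hφ1 : ContDiff ℝ 1 φ := hφ.of_le (by exact_mod_cast le_top)
  set T := translateComb c φ ψ
  have hloc : ∀ p j, ∀ x ∈ Ioo (c j) (c j + L),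
      T p x = p.1 j * φ (x - c j) + p.2 * σ j * cos (π / L * (x - c j)) := by
    intro p j x hx
    change ∑ i, p.1 i * φ (x - c i) + p.2 * ψ x = _
    rw [hψσ j x hx, Finset.sum_eq_single j, mul_assoc]
    · intro i _ hij
      rw [hφ0, mul_zero]
      intro h
      exact Set.disjoint_left.1 (hdisj hij) ⟨by linarith [h.1], by linarith [h.2]⟩ hx
    · simp
  have hderiv : ∀ p j, ∀ x ∈ Ioo (c j) (c j + L), deriv (T p) x =
      p.1 j * deriv φ (x - c j) - p.2 * σ j * (π / L * sin (π / L * (x - c j))) := by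
    intro p j x hx
    have heq : T p =ᶠ[nhds x]
        fun t => p.1 j * φ (t - c j) + p.2 * σ j * cos (π / L * (t - c j)) := by
      filter_upwards [Ioo_mem_nhds hx.1 hx.2] with t ht using hloc p j t ht
    have h1 : HasDerivAt (fun t => t - c j) 1 x := (hasDerivAt_id x).sub_const _
    have h2 : HasDerivAt (fun t => φ (t - c j)) (deriv φ (x - c j)) x :=
      HasDerivAt.comp_sub_const x (c j) ((hφ1.differentiable one_ne_zero) _).hasDerivAt
    have h3 : HasDerivAt (fun t => cos (π / L * (t - c j)))
        (-sin (π / L * (x - c j)) * (π / L)) x := by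
      simpa using (h1.const_mul (π / L)).cos
    have h4 : HasDerivAt (fun t => p.1 j * φ (t - c j) + p.2 * σ j * cos (π / L * (t - c j))) _ x :=
      (h2.const_mul (p.1 j)).add (h3.const_mul (p.2 * σ j))
    rw [heq.deriv_eq, h4.deriv]
    ring
  have hsmooth : ∀ p, ContDiff ℝ (⊤ : ℕ∞) (T p) := by
    intro p
    change ContDiff ℝ (⊤ : ℕ∞) fun x => ∑ i, p.1 i * φ (x - c i) + p.2 * ψ x
    refine (ContDiff.sum fun i _ => ?_).add (contDiff_const.mul hψ)
    exact contDiff_const.mul (hφ.comp (contDiff_id.sub contDiff_const))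
  have hsupp : ∀ p, HasCompactSupport (T p) := by
    intro p
    refine HasCompactSupport.intro ((isCompact_iUnion fun i =>
      isCompact_Icc (a := c i) (b := c i + L)).union hψc.isCompact) fun x hx => ?_
    rw [mem_union, not_or, mem_iUnion, not_exists] at hx
    change ∑ i, p.1 i * φ (x - c i) + p.2 * ψ x = 0
    rw [image_eq_zero_of_notMem_tsupport hx.2, mul_zero, add_zero]
    refine Finset.sum_eq_zero fun i _ => ?_
    rw [hφ0, mul_zero]
    exact fun h => hx.1 i ⟨by linarith [h.1], by linarith [h.2]⟩
  have hinj : Function.Injective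
      ((indicatorL (⋃ i, Ioo (c i) (c i + L))).comp T) := by
    rw [← LinearMap.ker_eq_bot, LinearMap.ker_eq_bot']
    intro p hp
    have hzero : ∀ j, ∀ x ∈ Ioo (c j) (c j + L), T p x = 0 := by
      intro j x hx
      have h := congrFun hp x
      change (⋃ i, Ioo (c i) (c i + L)).indicator (T p) x = 0 at h
      rwa [indicator_of_mem (mem_iUnion.2 ⟨j, hx⟩)] at h
    have hp2 : p.2 = 0 := by
      have hx1 : c ⟨0, hk⟩ + L / 4 ∈ Ioo (c ⟨0, hk⟩) (c ⟨0, hk⟩ + L) :=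
        ⟨by linarith, by linarith⟩
      have hx2 : c ⟨0, hk⟩ + (L - L / 4) ∈ Ioo (c ⟨0, hk⟩) (c ⟨0, hk⟩ + L) :=
        ⟨by linarith, by linarith⟩
      have h1 := hzero _ _ hx1
      have h2 := hzero _ _ hx2
      rw [hloc _ _ _ hx1, add_sub_cancel_left, hσ,
        show π / L * (L / 4) = π / 4 by field_simp] at h1
      rw [hloc _ _ _ hx2, add_sub_cancel_left, hσ, hsymm,
        show π / L * (L - L / 4) = π - π / 4 by field_simp, cos_pi_sub] at h2
      have h3 : p.2 * cos (π / 4) = 0 := by linarith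
      have h4 : 0 < cos (π / 4) := cos_pos_of_mem_Ioo ⟨by linarith [pi_pos], by linarith [pi_pos]⟩
      exact (mul_eq_zero.1 h3).resolve_right h4.ne'
    refine Prod.ext (funext fun j => ?_) hp2
    have hx : c j + L / 2 ∈ Ioo (c j) (c j + L) := ⟨by linarith, by linarith⟩
    have h := hzero _ _ hx
    rw [hloc _ _ _ hx, hp2, add_sub_cancel_left, zero_mul, zero_mul, add_zero] at h
    exact (mul_eq_zero.1 h).resolve_right hmid.ne'
  refine iInf_le_of_le ⟨LinearMap.range T, ?_, ?_⟩ (iSup_le ?_)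
  · rintro u ⟨p, rfl⟩
    exact ⟨hsmooth p, hsupp p⟩
  · rw [setOf_indicator_one_pos, ← LinearMap.range_comp, LinearMap.finrank_range_of_inj hinj]
    simp
  · rintro ⟨u, ⟨p, rfl⟩, -⟩
    have hcont : Continuous (T p) := (hsmooth p).continuous
    have hcont' : Continuous (deriv (T p)) := (hsmooth p).continuous_deriv (by simp)
    refine ENNReal.ofReal_le_ofReal ?_
    simp only
    rw [integral_indicator_iUnion_Ioo hL hdisj (g := fun x => T p x ^ 2) (hcont.pow 2),
      integral_indicator_iUnion_Ioo hL hdisj (g := fun x => deriv (T p) x ^ 2)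
        (hcont'.pow 2)]
    refine div_le_of_le_mul₀ (Finset.sum_nonneg fun i _ =>
      intervalIntegral.integral_nonneg (by linarith) fun x _ => sq_nonneg _) hC0 ?_
    rw [Finset.mul_sum]
    refine Finset.sum_le_sum fun j _ => ?_
    have h := rayleigh_add_cos_le hL hC.le hφ1 hsymm hφle (p.1 j) (p.2 * σ j)
    have e1 := intervalIntegral.integral_comp_sub_right (a := c j) (b := c j + L) (fun x =>
      (p.1 j * deriv φ x - p.2 * σ j * (π / L * sin (π / L * x))) ^ 2) (c j)
    have e2 := intervalIntegral.integral_comp_sub_right (a := c j) (b := c j + L) (fun x =>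
      (p.1 j * φ x + p.2 * σ j * cos (π / L * x)) ^ 2) (c j)
    rw [sub_self, add_sub_cancel_left] at e1 e2
    rw [← e1, ← e2] at h
    rw [← intervalIntegral_congr_Ioo (f := fun x => deriv (T p) x ^ 2) (by linarith)
        fun x hx => congrArg (· ^ 2) (hderiv p j x hx),
      ← intervalIntegral_congr_Ioo (f := fun x => T p x ^ 2) (by linarith)
        fun x hx => congrArg (· ^ 2) (hloc p j x hx)] at h
    exact h

/-- On `k` disjoint intervals of length `L`, every admissible space contains a function vanishing at
all midpoints, so `mu1 k` is at least the first Neumann eigenvalue of a single interval. -/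
theorem le_mu1_indicator {k : ℕ} {L : ℝ} (hL : 0 < L) {c : Fin k → ℝ}
    (hdisj : Pairwise fun i j => Disjoint (Ioo (c i) (c i + L)) (Ioo (c j) (c j + L))) :
    ENNReal.ofReal ((π / L) ^ 2) ≤ mu1 k ((⋃ i, Ioo (c i) (c i + L)).indicator 1) := by
  refine le_iInf ?_
  rintro ⟨V, hV, hrank⟩
  rw [setOf_indicator_one_pos] at hrank
  set S := ⋃ i, Ioo (c i) (c i + L)
  have hmid : ∀ i, c i + L / 2 ∈ S := fun i =>
    mem_iUnion.2 ⟨i, by linarith, by linarith⟩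
  have : FiniteDimensional ℝ (V.map (indicatorL S)) :=
    FiniteDimensional.of_finrank_pos (by omega)
  let E : V.map (indicatorL S) →ₗ[ℝ] (Fin k → ℝ) :=
    (LinearMap.pi fun i => LinearMap.proj (c i + L / 2)) ∘ₗ Submodule.subtype _
  have hE : LinearMap.ker E ≠ ⊥ := LinearMap.ker_ne_bot_of_finrank_lt (by
    rw [hrank, Module.finrank_fin_fun]; omega)
  obtain ⟨⟨w, hw⟩, hwE, hw0⟩ := (Submodule.ne_bot_iff _).1 hE
  obtain ⟨u, huV, rfl⟩ := hw
  have hu0 : indicatorL S u ≠ 0 := fun h => hw0 (Subtype.ext h)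
  have humid : ∀ i, u (c i + L / 2) = 0 := by
    intro i
    have h : S.indicator u (c i + L / 2) = 0 := congrFun hwE i
    rwa [indicator_of_mem (hmid i)] at h
  obtain ⟨hu, -⟩ := hV u huV
  have hcont : Continuous u := hu.continuous
  have hcont' : Continuous (deriv u) := hu.continuous_deriv (by simp)
  refine le_iSup_of_le ⟨u, huV, by rwa [setOf_indicator_one_pos]⟩ (ENNReal.ofReal_le_ofReal ?_)
  simp only
  rw [integral_indicator_iUnion_Ioo hL hdisj (g := fun x => u x ^ 2) (hcont.pow 2),
    integral_indicator_iUnion_Ioo hL hdisj (g := fun x => deriv u x ^ 2)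
        (hcont'.pow 2)]
  have hpos : 0 < ∑ i, ∫ x in (c i)..(c i + L), u x ^ 2 := by
    obtain ⟨x, hx⟩ := Function.ne_iff.1 hu0
    change S.indicator u x ≠ 0 at hx
    obtain ⟨j, hj⟩ := mem_iUnion.1 (mem_of_indicator_ne_zero hx)
    rw [indicator_of_mem (mem_iUnion.2 ⟨j, hj⟩)] at hx
    refine Finset.sum_pos' (fun i _ =>
      intervalIntegral.integral_nonneg (by linarith) fun x _ => sq_nonneg _)
      ⟨j, Finset.mem_univ j, ?_⟩
    exact intervalIntegral.integral_pos (by linarith) (hcont.pow 2).continuousOn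
      (fun x _ => sq_nonneg _) ⟨x, Ioo_subset_Icc_self hj, by positivity⟩
  rw [le_div_iff₀ hpos, Finset.mul_sum]
  exact Finset.sum_le_sum fun i _ =>
    sq_mul_integral_sq_le_of_midpoint (hu.of_le (by exact_mod_cast le_top)) hL (humid i)

/-- If `ρ` is the characteristic function of a disjoint union of `k` open intervals
in `ℝ`, each of length `m/k`, then `μ_k(ρ) = π² k² / m²`. -/
theorem stmt_1 (k : ℕ) (hk : 1 ≤ k) (m : ℝ) (hm : 0 < m) (c : Fin k → ℝ)
    (hdisj : Pairwise fun i j =>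
      Disjoint (Set.Ioo (c i) (c i + m / k)) (Set.Ioo (c j) (c j + m / k)))
    (ρ : ℝ → ℝ) (hρ : ρ = (⋃ i, Set.Ioo (c i) (c i + m / k)).indicator 1) :
    mu1 k ρ = ENNReal.ofReal (π ^ 2 * (k : ℝ) ^ 2 / m ^ 2) := by
  have hk0 : (0 : ℝ) < k := by exact_mod_cast hk
  have hL : 0 < m / k := by positivity
  rw [hρ, show π ^ 2 * (k : ℝ) ^ 2 / m ^ 2 = (π / (m / k)) ^ 2 by field_simp]
  refine le_antisymm ?_ (le_mu1_indicator hL hdisj)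
  refine ENNReal.le_of_forall_pos_le_add fun ε hε _ => ?_
  rw [← ENNReal.ofReal_coe_nnreal, ← ENNReal.ofReal_add (by positivity) ε.coe_nonneg]
  exact mu1_indicator_le hk hL hdisj (lt_add_of_pos_right _ (by exact_mod_cast hε))
end

section
/- Let δ > 0, a > 0, and ρ₁, ρ₂ : (0,a) → [δ, 1] be measurable. Set m = min(∫₀^a ρ₁, ∫₀^a ρ₂). Then the k-th eigenvalue of the problem -(ρ₁ u')' = μ ρ₂ u with Neumann boundary conditions on (0,a) satisfies μ_k(ρ₁, ρ₂) ≤ π² k² / m². -/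
open MeasureTheory Set ENNReal Real

/-- The `k`-th min-max eigenvalue of the Sturm-Liouville problem
`-(ρ₁ u')' = μ ρ₂ u` with Neumann conditions on the interval `(α, β)`:
the infimum, over subspaces of `C¹` functions whose restriction to `(α,β)` is
`(k+1)`-dimensional, of the maximum of the Rayleigh quotient
`(∫_α^β ρ₁ u'²)/(∫_α^β ρ₂ u²)` over nonzero elements. -/
noncomputable def muSL (k : ℕ) (α β : ℝ) (ρ₁ ρ₂ : ℝ → ℝ) : ℝ≥0∞ :=
  ⨅ V : {V : Submodule ℝ (ℝ → ℝ) //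
      (∀ u ∈ V, ContDiff ℝ 1 u) ∧
      Module.finrank ℝ (V.map (indicatorL (Set.Ioo α β))) = k + 1},
    ⨆ u : {u : ℝ → ℝ // u ∈ V.1 ∧ indicatorL (Set.Ioo α β) u ≠ 0},
    ENNReal.ofReal ((∫ x in Set.Ioo α β, ρ₁ x * (deriv u.1 x) ^ 2) /
      (∫ x in Set.Ioo α β, ρ₂ x * (u.1 x) ^ 2))

theorem integral_cos_int_mul (n : ℤ) :
    ∫ t in (0 : ℝ)..π, cos (n * t) = if n = 0 then π else 0 := by
  split_ifs with h
  · simp [h]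
  · have hn : (n : ℝ) ≠ 0 := by exact_mod_cast h
    rw [intervalIntegral.integral_comp_mul_left (fun t => cos t) hn]
    simp [Real.sin_int_mul_pi]

theorem integral_cos_mul_cos (i j : ℕ) :
    ∫ t in (0 : ℝ)..π, cos (i * t) * cos (j * t) =
      if i = j then (if j = 0 then π else π / 2) else 0 := by
  have h : ∀ t : ℝ, cos (i * t) * cos (j * t) =
      (cos (((i + j : ℤ) : ℝ) * t) + cos (((i - j : ℤ) : ℝ) * t)) / 2 := by
    intro t
    push_cast
    rw [add_mul, sub_mul, cos_add, cos_sub]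
    ring
  simp_rw [h]
  rw [intervalIntegral.integral_div, intervalIntegral.integral_add
    (Continuous.intervalIntegrable (by fun_prop) _ _)
    (Continuous.intervalIntegrable (by fun_prop) _ _), integral_cos_int_mul, integral_cos_int_mul]
  split_ifs <;> first | omega | ring

theorem integral_sin_mul_sin (i j : ℕ) :
    ∫ t in (0 : ℝ)..π, (i * sin (i * t)) * (j * sin (j * t)) =
      if i = j then (j : ℝ) ^ 2 * (π / 2) else 0 := by
  have h : ∀ t : ℝ, (i * sin (i * t)) * (j * sin (j * t)) =
      (i * j / 2 : ℝ) * (cos (((i - j : ℤ) : ℝ) * t) - cos (((i + j : ℤ) : ℝ) * t)) := by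
    intro t
    push_cast
    rw [add_mul, sub_mul, cos_add, cos_sub]
    ring
  simp_rw [h]
  rw [intervalIntegral.integral_const_mul, intervalIntegral.integral_sub
    (Continuous.intervalIntegrable (by fun_prop) _ _)
    (Continuous.intervalIntegrable (by fun_prop) _ _), integral_cos_int_mul, integral_cos_int_mul]
  by_cases hij : i = j
  · subst hij
    by_cases hi : i = 0
    · simp [hi]
    · have : ¬ ((i : ℤ) + i = 0) := by omega
      simp [hi]
      ring
  · have h₁ : ¬ ((i : ℤ) - j = 0) := by omega
    have h₂ : ¬ ((i : ℤ) + j = 0) := by omega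
    simp [hij, h₁, h₂]

theorem integral_sq_sum_of_orthogonal {ι : Type*} [Fintype ι] [DecidableEq ι] (e : ι → ℝ → ℝ)
    (he : ∀ i, Continuous (e i)) (w : ι → ℝ) (α β : ℝ)
    (horth : ∀ i j, ∫ t in α..β, e i t * e j t = if i = j then w j else 0) (c : ι → ℝ) :
    ∫ t in α..β, (∑ j, c j * e j t) ^ 2 = ∑ j, c j ^ 2 * w j := by
  have h : ∀ t, (∑ j, c j * e j t) ^ 2 = ∑ i, ∑ j, (c i * c j) * (e i t * e j t) := by
    intro t
    rw [sq, Finset.sum_mul_sum]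
    exact Finset.sum_congr rfl fun i _ => Finset.sum_congr rfl fun j _ => by ring
  simp_rw [h]
  rw [intervalIntegral.integral_finsetSum
    fun i _ => Continuous.intervalIntegrable (by fun_prop) _ _]
  refine Finset.sum_congr rfl fun i _ => ?_
  rw [intervalIntegral.integral_finsetSum
    fun j _ => Continuous.intervalIntegrable (by fun_prop) _ _]
  simp_rw [intervalIntegral.integral_const_mul, horth]
  simp [sq]

/-- The cosine polynomial with coefficients `c`. -/
noncomputable def cosPoly {k : ℕ} (c : Fin (k + 1) → ℝ) (t : ℝ) : ℝ :=
  ∑ j, c j * cos ((j : ℕ) * t)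

/-- The negative of the derivative of `cosPoly c`. -/
noncomputable def sinPoly {k : ℕ} (c : Fin (k + 1) → ℝ) (t : ℝ) : ℝ :=
  ∑ j, c j * ((j : ℕ) * sin ((j : ℕ) * t))

theorem continuous_cosPoly {k : ℕ} (c : Fin (k + 1) → ℝ) : Continuous (cosPoly c) := by
  unfold cosPoly; fun_prop

theorem continuous_sinPoly {k : ℕ} (c : Fin (k + 1) → ℝ) : Continuous (sinPoly c) := by
  unfold sinPoly; fun_prop

theorem hasDerivAt_cosPoly {k : ℕ} (c : Fin (k + 1) → ℝ) (t : ℝ) :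
    HasDerivAt (cosPoly c) (-sinPoly c t) t := by
  unfold cosPoly sinPoly
  rw [← Finset.sum_neg_distrib]
  refine HasDerivAt.fun_sum fun j _ => ?_
  exact ((((hasDerivAt_id' t).const_mul ((j : ℕ) : ℝ)).cos).const_mul (c j)).congr_deriv (by ring)

theorem integral_cosPoly_sq {k : ℕ} (c : Fin (k + 1) → ℝ) :
    ∫ t in (0 : ℝ)..π, cosPoly c t ^ 2 =
      ∑ j, c j ^ 2 * (if (j : ℕ) = 0 then π else π / 2) := by
  refine integral_sq_sum_of_orthogonal (fun (j : Fin (k + 1)) t => cos ((j : ℕ) * t))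
    (fun i => by fun_prop) _ _ _ (fun i j => ?_) c
  simp only [integral_cos_mul_cos, Fin.ext_iff]

theorem integral_sinPoly_sq {k : ℕ} (c : Fin (k + 1) → ℝ) :
    ∫ t in (0 : ℝ)..π, sinPoly c t ^ 2 = ∑ j, c j ^ 2 * (((j : ℕ) : ℝ) ^ 2 * (π / 2)) := by
  refine integral_sq_sum_of_orthogonal (fun (j : Fin (k + 1)) t => (j : ℕ) * sin ((j : ℕ) * t))
    (fun i => by fun_prop) _ _ _ (fun i j => ?_) c
  simp only [integral_sin_mul_sin, Fin.ext_iff]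

theorem sum_sq_le_integral_cosPoly_sq {k : ℕ} (c : Fin (k + 1) → ℝ) :
    (∑ j, c j ^ 2) * (π / 2) ≤ ∫ t in (0 : ℝ)..π, cosPoly c t ^ 2 := by
  rw [integral_cosPoly_sq, Finset.sum_mul]
  refine Finset.sum_le_sum fun j _ => mul_le_mul_of_nonneg_left ?_ (sq_nonneg _)
  split_ifs <;> linarith [pi_pos]

theorem integral_cosPoly_sq_pos {k : ℕ} {c : Fin (k + 1) → ℝ} (hc : c ≠ 0) :
    0 < ∫ t in (0 : ℝ)..π, cosPoly c t ^ 2 := by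
  obtain ⟨j, hj⟩ := Function.ne_iff.mp hc
  have : 0 < ∑ j, c j ^ 2 :=
    Finset.sum_pos' (fun _ _ => sq_nonneg _) ⟨j, Finset.mem_univ _, sq_pos_of_ne_zero hj⟩
  exact lt_of_lt_of_le (by positivity) (sum_sq_le_integral_cosPoly_sq c)

theorem integral_sinPoly_sq_le {k : ℕ} (c : Fin (k + 1) → ℝ) :
    ∫ t in (0 : ℝ)..π, sinPoly c t ^ 2 ≤
      (k : ℝ) ^ 2 * ∫ t in (0 : ℝ)..π, cosPoly c t ^ 2 := by
  refine le_trans ?_ (mul_le_mul_of_nonneg_left (sum_sq_le_integral_cosPoly_sq c) (sq_nonneg _))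
  rw [integral_sinPoly_sq, Finset.sum_mul, Finset.mul_sum]
  refine Finset.sum_le_sum fun j _ => ?_
  have hj : ((j : ℕ) : ℝ) ≤ k := by exact_mod_cast Nat.lt_succ_iff.mp j.2
  have hj2 : ((j : ℕ) : ℝ) ^ 2 ≤ (k : ℝ) ^ 2 := by gcongr
  have := mul_le_mul_of_nonneg_right hj2 (by positivity : 0 ≤ c j ^ 2 * (π / 2))
  linarith

theorem cosPoly_sq_le {k : ℕ} (c : Fin (k + 1) → ℝ) (t : ℝ) :
    cosPoly c t ^ 2 ≤ 2 * (k + 1) / π * ∫ t in (0 : ℝ)..π, cosPoly c t ^ 2 := by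
  have h₁ : cosPoly c t ^ 2 ≤ (k + 1) * ∑ j, c j ^ 2 := by
    have := sq_sum_le_card_mul_sum_sq (s := Finset.univ)
      (f := fun j : Fin (k + 1) => c j * cos ((j : ℕ) * t))
    simp only [Finset.card_univ, Fintype.card_fin, Nat.cast_add, Nat.cast_one] at this
    refine this.trans (mul_le_mul_of_nonneg_left (Finset.sum_le_sum fun j _ => ?_) (by positivity))
    rw [mul_pow]
    exact mul_le_of_le_one_right (sq_nonneg _) (cos_sq_le_one _)
  have h₂ := mul_le_mul_of_nonneg_left (sum_sq_le_integral_cosPoly_sq c)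
    (by positivity : 0 ≤ 2 * (k + 1) / π)
  refine h₁.trans (le_trans (le_of_eq ?_) h₂)
  field_simp

/-- Cosine polynomials in the variable `θ`, as a linear map on coefficients. -/
noncomputable def cosPolyComp (k : ℕ) (θ : ℝ → ℝ) : (Fin (k + 1) → ℝ) →ₗ[ℝ] (ℝ → ℝ) where
  toFun c := fun x => cosPoly c (θ x)
  map_add' c d := by ext x; simp [cosPoly, add_mul, Finset.sum_add_distrib]
  map_smul' r c := by ext x; simp [cosPoly, mul_assoc, Finset.mul_sum]

theorem setIntegral_comp_mul_deriv {a : ℝ} (ha : 0 < a) {θ θ' g : ℝ → ℝ}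
    (hθ : ∀ x, HasDerivAt θ (θ' x) x) (hθ' : Continuous θ') (hθ0 : θ 0 = 0) (hθa : θ a = π)
    (hg : Continuous g) :
    ∫ x in Ioo 0 a, g (θ x) * θ' x = ∫ t in (0 : ℝ)..π, g t := by
  rw [← integral_Ioc_eq_integral_Ioo, ← intervalIntegral.integral_of_le ha.le]
  have := intervalIntegral.integral_comp_mul_deriv (a := 0) (b := a) (fun x _ => hθ x)
    hθ'.continuousOn hg
  rwa [hθ0, hθa] at this

theorem integrableOn_Ioo_of_abs_le_one_mul_continuous {a : ℝ} {ρ g : ℝ → ℝ} (hρ : Measurable ρ)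
    (hρ1 : ∀ x ∈ Ioo 0 a, |ρ x| ≤ 1) (hg : Continuous g) :
    IntegrableOn (fun x => ρ x * g x) (Ioo 0 a) := by
  have hgi : IntegrableOn g (Ioo 0 a) :=
    (hg.integrableOn_Icc (a := 0) (b := a)).mono_set Ioo_subset_Icc_self
  refine Integrable.bdd_mul (c := 1) hgi hρ.aestronglyMeasurable ?_
  exact (ae_restrict_iff' measurableSet_Ioo).mpr (Filter.Eventually.of_forall hρ1)

/-- The Rayleigh quotient of a cosine polynomial in a rescaled primitive of `σ`, where `σ` is a
continuous approximation of `ρ₂`. -/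
theorem rayleigh_cosPoly_le {a : ℝ} (ha : 0 < a) {ρ₁ ρ₂ σ θ : ℝ → ℝ}
    (hm1 : Measurable ρ₁) (hm2 : Measurable ρ₂)
    (h1 : ∀ x ∈ Ioo 0 a, 0 ≤ ρ₁ x ∧ ρ₁ x ≤ 1) (h2 : ∀ x ∈ Ioo 0 a, 0 ≤ ρ₂ x ∧ ρ₂ x ≤ 1)
    (hσ : Continuous σ) (hσ01 : ∀ x, 0 ≤ σ x ∧ σ x ≤ 1) {M ε : ℝ} (hM : 0 < M)
    (hε : ∫ x in Ioo 0 a, |ρ₂ x - σ x| ≤ ε)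
    (hθ : ∀ x, HasDerivAt θ (π / M * σ x) x) (hθ0 : θ 0 = 0) (hθa : θ a = π)
    {k : ℕ} (hMε : 2 * (k + 1) * ε < M) {c : Fin (k + 1) → ℝ} (hc : c ≠ 0) :
    (∫ x in Ioo 0 a, ρ₁ x * deriv (fun x => cosPoly c (θ x)) x ^ 2) /
      (∫ x in Ioo 0 a, ρ₂ x * cosPoly c (θ x) ^ 2) ≤
      π ^ 2 * k ^ 2 / (M * (M - 2 * (k + 1) * ε)) := by
  set A := ∫ t in (0 : ℝ)..π, cosPoly c t ^ 2 with hA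
  have hApos : 0 < A := integral_cosPoly_sq_pos hc
  have hθc : Continuous θ := continuous_iff_continuousAt.mpr fun x => (hθ x).continuousAt
  have hcc := continuous_cosPoly c
  have hsc := continuous_sinPoly c
  have hσi : ∀ g : ℝ → ℝ, Continuous g → IntegrableOn g (Ioo 0 a) := fun g hg =>
    (hg.integrableOn_Icc (a := 0) (b := a)).mono_set Ioo_subset_Icc_self
  have hder : ∀ x, deriv (fun x => cosPoly c (θ x)) x = -sinPoly c (θ x) * (π / M * σ x) :=
    fun x => ((hasDerivAt_cosPoly c (θ x)).comp x (hθ x)).deriv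
  have hnum : ∫ x in Ioo 0 a, ρ₁ x * deriv (fun x => cosPoly c (θ x)) x ^ 2 ≤
      π / M * (k ^ 2 * A) := by
    calc _ ≤ ∫ x in Ioo 0 a, π / M * (sinPoly c (θ x) ^ 2 * (π / M * σ x)) := by
          simp_rw [hder]
          refine setIntegral_mono_on ?_ (hσi _ (by fun_prop)) measurableSet_Ioo fun x hx => ?_
          · exact integrableOn_Ioo_of_abs_le_one_mul_continuous hm1
              (fun x hx => abs_le.mpr ⟨by linarith [(h1 x hx).1], (h1 x hx).2⟩) (by fun_prop)
          · have hle : ρ₁ x * σ x ≤ 1 := mul_le_one₀ (h1 x hx).2 (hσ01 x).1 (hσ01 x).2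
            have hnn : 0 ≤ π / M * (sinPoly c (θ x) ^ 2 * (π / M * σ x)) := by
              have := (hσ01 x).1
              positivity
            calc _ = (ρ₁ x * σ x) * (π / M * (sinPoly c (θ x) ^ 2 * (π / M * σ x))) := by ring
              _ ≤ _ := mul_le_of_le_one_left hnn hle
      _ = π / M * ∫ t in (0 : ℝ)..π, sinPoly c t ^ 2 := by
          rw [integral_const_mul, setIntegral_comp_mul_deriv (g := fun t => sinPoly c t ^ 2)
            ha hθ (by fun_prop) hθ0 hθa (by fun_prop)]
      _ ≤ _ := mul_le_mul_of_nonneg_left (integral_sinPoly_sq_le c) (by positivity)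
  have hρ₂i : ∀ g : ℝ → ℝ, Continuous g → IntegrableOn (fun x => ρ₂ x * g x) (Ioo 0 a) :=
    fun g hg => integrableOn_Ioo_of_abs_le_one_mul_continuous hm2
      (fun x hx => abs_le.mpr ⟨by linarith [(h2 x hx).1], (h2 x hx).2⟩) hg
  have hden : A / π * (M - 2 * (k + 1) * ε) ≤ ∫ x in Ioo 0 a, ρ₂ x * cosPoly c (θ x) ^ 2 := by
    have hσint : ∫ x in Ioo 0 a, M / π * (cosPoly c (θ x) ^ 2 * (π / M * σ x)) = M / π * A := by
      rw [integral_const_mul, setIntegral_comp_mul_deriv (g := fun t => cosPoly c t ^ 2)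
        ha hθ (by fun_prop) hθ0 hθa (by fun_prop)]
    have hdiff : IntegrableOn (fun x => |ρ₂ x - σ x|) (Ioo 0 a) := by
      have := hρ₂i (fun _ => 1) continuous_const
      simp only [mul_one] at this
      exact (this.sub (hσi σ hσ)).abs
    have hK : 0 ≤ 2 * (k + 1) / π * A := by positivity
    calc A / π * (M - 2 * (k + 1) * ε) = M / π * A - ε * (2 * (k + 1) / π * A) := by ring
      _ ≤ M / π * A - (∫ x in Ioo 0 a, |ρ₂ x - σ x|) * (2 * (k + 1) / π * A) := by gcongr
      _ = ∫ x in Ioo 0 a, (M / π * (cosPoly c (θ x) ^ 2 * (π / M * σ x)) -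
            |ρ₂ x - σ x| * (2 * (k + 1) / π * A)) := by
          rw [integral_sub (hσi _ (by fun_prop)) (hdiff.mul_const _), hσint, integral_mul_const]
      _ ≤ _ := by
          refine setIntegral_mono_on ((hσi _ (by fun_prop)).sub (hdiff.mul_const _))
            (hρ₂i _ (by fun_prop)) measurableSet_Ioo fun x _ => ?_
          have e : M / π * (cosPoly c (θ x) ^ 2 * (π / M * σ x)) = σ x * cosPoly c (θ x) ^ 2 := by
            field_simp
          have h₁ : (σ x - ρ₂ x) * cosPoly c (θ x) ^ 2 ≤ |ρ₂ x - σ x| * cosPoly c (θ x) ^ 2 :=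
            mul_le_mul_of_nonneg_right (by rw [abs_sub_comm]; exact le_abs_self _) (sq_nonneg _)
          have h₂ := mul_le_mul_of_nonneg_left (cosPoly_sq_le c (θ x)) (abs_nonneg (ρ₂ x - σ x))
          rw [e]
          linarith
  have hMε' : 0 < M - 2 * (k + 1) * ε := by linarith
  calc _ ≤ π / M * (k ^ 2 * A) / (A / π * (M - 2 * (k + 1) * ε)) :=
        div_le_div₀ (by positivity) hnum (by positivity) hden
    _ = _ := by field_simp

theorem exists_continuous_integral_abs_sub_le {a : ℝ} {ρ : ℝ → ℝ} (hm : Measurable ρ)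
    (h : ∀ x ∈ Ioo 0 a, 0 ≤ ρ x ∧ ρ x ≤ 1) {ε : ℝ} (hε : 0 < ε) :
    ∃ σ : ℝ → ℝ, Continuous σ ∧ (∀ x, 0 ≤ σ x ∧ σ x ≤ 1) ∧
      ∫ x in Ioo 0 a, |ρ x - σ x| ≤ ε := by
  have hρi : IntegrableOn ρ (Ioo 0 a) := by
    simpa using integrableOn_Ioo_of_abs_le_one_mul_continuous hm
      (fun x hx => abs_le.mpr ⟨by linarith [(h x hx).1], (h x hx).2⟩)
      (continuous_const (y := (1 : ℝ)))
  obtain ⟨g, -, hg, hgc, hgi⟩ := hρi.exists_hasCompactSupport_integral_sub_le hε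
  have hσc : Continuous fun x => max 0 (min 1 (g x)) := by fun_prop
  refine ⟨fun x => max 0 (min 1 (g x)), hσc,
    fun x => ⟨le_max_left _ _, max_le zero_le_one (min_le_left _ _)⟩, le_trans ?_ hg⟩
  refine setIntegral_mono_on ?_ (hρi.sub hgi).norm measurableSet_Ioo fun x hx => ?_
  · exact (hρi.sub
      ((hσc.integrableOn_Icc (a := 0) (b := a)).mono_set Ioo_subset_Icc_self)).abs
  · have e : ρ x = max 0 (min 1 (ρ x)) := by
      rw [min_eq_right (h x hx).2, max_eq_right (h x hx).1]
    rw [Real.norm_eq_abs]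
    nth_rewrite 1 [e]
    refine (abs_max_sub_max_le_max _ _ _ _).trans ?_
    refine max_le (by simp) ((abs_min_sub_min_le_max _ _ _ _).trans (max_le (by simp) le_rfl))

theorem muSL_le_of_approx {a : ℝ} (ha : 0 < a) {ρ₁ ρ₂ : ℝ → ℝ}
    (hm1 : Measurable ρ₁) (hm2 : Measurable ρ₂)
    (h1 : ∀ x ∈ Ioo 0 a, 0 ≤ ρ₁ x ∧ ρ₁ x ≤ 1) (h2 : ∀ x ∈ Ioo 0 a, 0 ≤ ρ₂ x ∧ ρ₂ x ≤ 1)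
    (k : ℕ) {η : ℝ} (hη : 0 < η) (hηM : η < ∫ x in Ioo 0 a, ρ₂ x) :
    muSL k 0 a ρ₁ ρ₂ ≤
      ENNReal.ofReal (π ^ 2 * (k : ℝ) ^ 2 / ((∫ x in Ioo 0 a, ρ₂ x) - η) ^ 2) := by
  obtain ⟨ε, hε, hεη⟩ : ∃ ε : ℝ, 0 < ε ∧ (2 * (k + 1) + 1) * ε = η :=
    ⟨η / (2 * (k + 1) + 1), by positivity, by field_simp⟩
  obtain ⟨σ, hσ, hσ01, hσε⟩ := exists_continuous_integral_abs_sub_le hm2 h2 hε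
  set M := ∫ x in Ioo 0 a, σ x with hMdef
  have hσi : IntegrableOn σ (Ioo 0 a) :=
    (hσ.integrableOn_Icc (a := 0) (b := a)).mono_set Ioo_subset_Icc_self
  have hρi : IntegrableOn ρ₂ (Ioo 0 a) := by
    simpa using integrableOn_Ioo_of_abs_le_one_mul_continuous hm2
      (fun x hx => abs_le.mpr ⟨by linarith [(h2 x hx).1], (h2 x hx).2⟩)
      (continuous_const (y := (1 : ℝ)))
  have hMge : (∫ x in Ioo 0 a, ρ₂ x) - ε ≤ M := by
    have := integral_mono (hρi.sub hσi) (hρi.sub hσi).abs fun x => le_abs_self _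
    have e : ∫ x in Ioo 0 a, (ρ₂ - σ) x = (∫ x in Ioo 0 a, ρ₂ x) - M := integral_sub hρi hσi
    rw [e] at this
    have := this.trans hσε
    linarith
  have hkε : 0 ≤ 2 * (k + 1) * ε := by positivity
  have hMε : 2 * (k + 1) * ε < M := by linarith
  have hM : 0 < M := by linarith
  set θ : ℝ → ℝ := fun x => π / M * ∫ t in (0 : ℝ)..x, σ t with hθdef
  have hθ : ∀ x, HasDerivAt θ (π / M * σ x) x := fun x =>
    (intervalIntegral.integral_hasDerivAt_right (hσ.intervalIntegrable _ _)
      (hσ.stronglyMeasurableAtFilter _ _) hσ.continuousAt).const_mul _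
  have hθ0 : θ 0 = 0 := by simp [hθdef]
  have hθa : θ a = π := by
    simp only [hθdef]
    rw [intervalIntegral.integral_of_le ha.le, integral_Ioc_eq_integral_Ioo, ← hMdef]
    field_simp
  have hC1 : ∀ c : Fin (k + 1) → ℝ, ContDiff ℝ 1 (cosPolyComp k θ c) := by
    intro c
    have hθC : ContDiff ℝ 1 θ := by
      rw [contDiff_one_iff_deriv]
      refine ⟨fun x => (hθ x).differentiableAt, ?_⟩
      rw [funext fun x => (hθ x).deriv]
      fun_prop
    change ContDiff ℝ 1 fun x => ∑ j : Fin (k + 1), c j * cos ((j : ℕ) * θ x)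
    fun_prop
  have hinj : Function.Injective (indicatorL (Ioo 0 a) ∘ₗ cosPolyComp k θ) := by
    rw [injective_iff_map_eq_zero]
    intro c hc
    by_contra hne
    have hpos := integral_cosPoly_sq_pos hne
    have hcc := continuous_cosPoly c
    rw [← setIntegral_comp_mul_deriv (g := fun t => cosPoly c t ^ 2) ha hθ (by fun_prop) hθ0 hθa
      (by fun_prop), setIntegral_eq_zero_of_forall_eq_zero] at hpos
    · exact lt_irrefl _ hpos
    · intro x hx
      have hx0 : (Ioo 0 a).indicator (cosPolyComp k θ c) x = 0 := congrFun hc x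
      rw [indicator_of_mem hx] at hx0
      have : cosPoly c (θ x) = 0 := hx0
      simp [this]
  refine iInf_le_of_le ⟨LinearMap.range (cosPolyComp k θ), ?_, ?_⟩ ?_
  · rintro _ ⟨c, rfl⟩
    exact hC1 c
  · rw [← LinearMap.range_comp, LinearMap.finrank_range_of_inj hinj]
    simp
  · refine iSup_le ?_
    rintro ⟨_, ⟨c, rfl⟩, hu⟩
    have hc : c ≠ 0 := by
      rintro rfl
      simp at hu
    refine ENNReal.ofReal_le_ofReal
      ((rayleigh_cosPoly_le ha hm1 hm2 h1 h2 hσ hσ01 hM hσε hθ hθ0 hθa hMε hc).trans ?_)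
    rw [sq ((∫ x in Ioo 0 a, ρ₂ x) - η)]
    have : 0 < (∫ x in Ioo 0 a, ρ₂ x) - η := by linarith
    refine div_le_div_of_nonneg_left (by positivity) (by positivity)
      (mul_le_mul ?_ ?_ this.le hM.le) <;> linarith

/-- Sharp bound for nondegenerate pairs of weights on an interval: if
`ρ₁, ρ₂ : (0,a) → [δ,1]` and `m = min(∫ρ₁, ∫ρ₂)`, then the `k`-th Neumann eigenvalue of
`-(ρ₁u')' = μ ρ₂ u` satisfies `μ_k(ρ₁,ρ₂) ≤ π²k²/m²`. -/
theorem stmt_5 (δ a : ℝ) (hδ : 0 < δ) (ha : 0 < a) (ρ₁ ρ₂ : ℝ → ℝ)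
    (hm1 : Measurable ρ₁) (hm2 : Measurable ρ₂)
    (h1 : ∀ x ∈ Set.Ioo 0 a, δ ≤ ρ₁ x ∧ ρ₁ x ≤ 1)
    (h2 : ∀ x ∈ Set.Ioo 0 a, δ ≤ ρ₂ x ∧ ρ₂ x ≤ 1) (k : ℕ) :
    muSL k 0 a ρ₁ ρ₂ ≤ ENNReal.ofReal (π ^ 2 * (k : ℝ) ^ 2 /
      (min (∫ x in Set.Ioo 0 a, ρ₁ x) (∫ x in Set.Ioo 0 a, ρ₂ x)) ^ 2) := by
  have hpos1 : ∀ x ∈ Ioo 0 a, 0 ≤ ρ₁ x ∧ ρ₁ x ≤ 1 := fun x hx => ⟨hδ.le.trans (h1 x hx).1, (h1 x hx).2⟩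
  have hpos2 : ∀ x ∈ Ioo 0 a, 0 ≤ ρ₂ x ∧ ρ₂ x ≤ 1 := fun x hx => ⟨hδ.le.trans (h2 x hx).1, (h2 x hx).2⟩
  have hint : ∀ ρ : ℝ → ℝ, Measurable ρ → (∀ x ∈ Ioo 0 a, δ ≤ ρ x ∧ ρ x ≤ 1) →
      0 < ∫ x in Ioo 0 a, ρ x := by
    intro ρ hm h
    have hρi : IntegrableOn ρ (Ioo 0 a) := by
      simpa using integrableOn_Ioo_of_abs_le_one_mul_continuous hm
        (fun x hx => abs_le.mpr ⟨by linarith [(h x hx).1], (h x hx).2⟩)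
        (continuous_const (y := (1 : ℝ)))
    have hle : ∫ _ in Ioo 0 a, δ ≤ ∫ x in Ioo 0 a, ρ x :=
      setIntegral_mono_on (integrableOn_const (by simp)) hρi measurableSet_Ioo fun x hx => (h x hx).1
    refine lt_of_lt_of_le ?_ hle
    simp [ha.le]
    positivity
  have hM1 := hint ρ₁ hm1 h1
  have hM2 := hint ρ₂ hm2 h2
  have hlim : Filter.Tendsto
      (fun η : ℝ => ENNReal.ofReal (π ^ 2 * (k : ℝ) ^ 2 / ((∫ x in Ioo 0 a, ρ₂ x) - η) ^ 2))
      (nhdsWithin 0 (Ioi 0))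
      (nhds (ENNReal.ofReal (π ^ 2 * (k : ℝ) ^ 2 / ((∫ x in Ioo 0 a, ρ₂ x) - 0) ^ 2))) := by
    refine (ENNReal.continuous_ofReal.continuousAt.comp (ContinuousAt.div ?_ ?_ ?_)).tendsto.mono_left
      nhdsWithin_le_nhds
    · fun_prop
    · fun_prop
    · rw [sub_zero]
      positivity
  rw [sub_zero] at hlim
  refine (ge_of_tendsto hlim ?_).trans (ENNReal.ofReal_le_ofReal ?_)
  · filter_upwards [Ioo_mem_nhdsGT hM2] with η hη
    exact muSL_le_of_approx ha hm1 hm2 hpos1 hpos2 k hη.1 hη.2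
  · have := lt_min hM1 hM2
    gcongr
    exact min_le_right _ _
end

section
/- Let ρ : [0,a] → [δ,1] with δ > 0 and ∫₀^a ρ = 1. Suppose P = (a₁,…,a_k) ∈ ℝ^k is such that the piecewise function g_P (built from translates of h(x) = -1 for x < -1/(2k), sin(kπx) for |x| ≤ 1/(2k), and 1 for x > 1/(2k), glued with alternating signs at the ordered points of P) is ρ-orthogonal to the Neumann eigenfunctions u₀ = 1, u₁, …, u_{k-1} of -( ρ u')' = μ ρ u on (0,a). Then (∫₀^a ρ (g_P')² dx)/(∫₀^a ρ g_P² dx) ≤ π² k², and consequently μ_k(ρ) ≤ π²k². -/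
open MeasureTheory Set ENNReal Real

/-- The profile function `h`: equal to `-1` left of `-1/(2k)`, to `sin(kπx)` on
`[-1/(2k), 1/(2k)]`, and to `1` right of `1/(2k)`. -/
noncomputable def hfun (k : ℕ) (x : ℝ) : ℝ :=
  if x < -(1 / (2 * (k : ℝ))) then -1
  else if x ≤ 1 / (2 * (k : ℝ)) then Real.sin ((k : ℝ) * π * x) else 1

/-- The test function `g_P` associated to the ordered points `b 0 ≤ … ≤ b (k-1)`:
with `c x = #{i < k : b i < x}`, on the region where `c x = j` it equals
`(-1)^j min(|h(· - b_{j-1})|, |h(· - b_j)|)` (interpreting the out-of-range indices at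
the two extreme regions so that `g_P = -h(· - b 0)` left of all points and
`g_P = (-1)^k h(· - b (k-1))` right of all points). -/
noncomputable def gP (k : ℕ) (b : ℕ → ℝ) (x : ℝ) : ℝ :=
  (-1 : ℝ) ^ (((Finset.range k).filter fun i => b i < x).card) *
    min |hfun k (x - b ((((Finset.range k).filter fun i => b i < x).card) - 1))|
        |hfun k (x - b (Nat.min (((Finset.range k).filter fun i => b i < x).card) (k - 1)))|

theorem abs_hfun {k : ℕ} (hk : 1 ≤ k) (t : ℝ) :
    |hfun k t| = Real.sin (min (k * π * |t|) (π / 2)) := by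
  have hk0 : (0 : ℝ) < k := by exact_mod_cast hk
  have hpi := Real.pi_pos
  have hw : (k : ℝ) * π * (1 / (2 * k)) = π / 2 := by field_simp
  have hkp : (0 : ℝ) < k * π := by positivity
  by_cases ht : |t| ≤ 1 / (2 * k)
  · have h1 : (k : ℝ) * π * |t| ≤ π / 2 := hw ▸ mul_le_mul_of_nonneg_left ht hkp.le
    have h2 := abs_le.mp ht
    rw [hfun, if_neg (by linarith), if_pos h2.2, min_eq_left h1]
    rcases abs_cases t with ⟨h, h'⟩ | ⟨h, h'⟩
    · rw [h] at h1 ⊢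
      exact abs_of_nonneg (Real.sin_nonneg_of_nonneg_of_le_pi (by positivity) (by linarith))
    · rw [h] at h1 ⊢
      rw [mul_neg, Real.sin_neg]
      refine abs_of_nonpos (Real.sin_nonpos_of_nonpos_of_neg_pi_le ?_ (by linarith))
      nlinarith
  · have h1 : π / 2 ≤ (k : ℝ) * π * |t| :=
      hw ▸ mul_le_mul_of_nonneg_left (not_le.mp ht).le hkp.le
    rw [min_eq_right h1, Real.sin_pi_div_two, hfun]
    have hw0 : (0 : ℝ) < 1 / (2 * k) := by positivity
    rcases lt_abs.mp (not_le.mp ht) with h | h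
    · rw [if_neg (by linarith), if_neg (by linarith), abs_one]
    · rw [if_pos (by linarith), abs_neg, abs_one]

theorem abs_hfun_mono {k : ℕ} (hk : 1 ≤ k) {s t : ℝ} (h : |s| ≤ |t|) :
    |hfun k s| ≤ |hfun k t| := by
  have hpi := Real.pi_pos
  rw [abs_hfun hk, abs_hfun hk]
  have h0 : 0 ≤ min (k * π * |s|) (π / 2) := le_min (by positivity) (by positivity)
  exact Real.sin_le_sin_of_le_of_le_pi_div_two (by linarith) (min_le_right _ _)
    (min_le_min_right _ (by gcongr))

theorem abs_hfun_le_one {k : ℕ} (hk : 1 ≤ k) (t : ℝ) : |hfun k t| ≤ 1 :=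
  abs_hfun hk t ▸ Real.sin_le_one _

theorem hfun_ne_zero {k : ℕ} (hk : 1 ≤ k) {t : ℝ} (ht : t ≠ 0) : hfun k t ≠ 0 := by
  have hpi := Real.pi_pos
  have hk0 : (0 : ℝ) < k := by exact_mod_cast hk
  rw [← abs_pos, abs_hfun hk]
  have := abs_pos.mpr ht
  refine Real.sin_pos_of_pos_of_lt_pi (lt_min (by positivity) (by positivity)) ?_
  exact (min_le_right _ _).trans_lt (by linarith)

theorem measurable_hfun (k : ℕ) : Measurable (hfun k) :=
  Measurable.ite measurableSet_Iio measurable_const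
    (Measurable.ite measurableSet_Iic (by fun_prop) measurable_const)

/-- Away from its two corners, the profile solves `h'² = k²π²(1 - h²)`. -/
theorem exists_hasDerivAt_hfun {k : ℕ} (hk : 1 ≤ k) {t : ℝ} (h1 : t ≠ -(1 / (2 * (k : ℝ))))
    (h2 : t ≠ 1 / (2 * (k : ℝ))) :
    ∃ d, HasDerivAt (hfun k) d t ∧ d ^ 2 = π ^ 2 * (k : ℝ) ^ 2 * (1 - hfun k t ^ 2) := by
  have hk0 : (0 : ℝ) < k := by exact_mod_cast hk
  have hw0 : (0 : ℝ) < 1 / (2 * k) := by positivity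
  rcases lt_or_gt_of_ne h1 with h | h
  · have he : hfun k =ᶠ[nhds t] fun _ => -1 := by
      filter_upwards [Iio_mem_nhds h] with x hx
      exact if_pos hx
    refine ⟨0, (hasDerivAt_const t (-1 : ℝ)).congr_of_eventuallyEq he, ?_⟩
    rw [he.self_of_nhds]; ring
  rcases lt_or_gt_of_ne h2 with h' | h'
  · have he : hfun k =ᶠ[nhds t] fun x => Real.sin ((k : ℝ) * π * x) := by
      filter_upwards [Ioo_mem_nhds h h'] with x hx
      rw [hfun, if_neg (not_lt.mpr hx.1.le), if_pos hx.2.le]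
    refine ⟨_, (((hasDerivAt_id t).const_mul ((k : ℝ) * π)).sin).congr_of_eventuallyEq he, ?_⟩
    rw [he.self_of_nhds, ← Real.cos_sq']
    simp only [id]
    ring
  · have he : hfun k =ᶠ[nhds t] fun _ => 1 := by
      filter_upwards [Ioi_mem_nhds h'] with x hx
      have hx' : 1 / (2 * (k : ℝ)) < x := hx
      rw [hfun, if_neg (by linarith), if_neg (by linarith)]
    refine ⟨0, (hasDerivAt_const t (1 : ℝ)).congr_of_eventuallyEq he, ?_⟩
    rw [he.self_of_nhds]; ring

theorem one_sub_hfun_sq_eq {k : ℕ} (hk : 1 ≤ k) :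
    (fun t => 1 - hfun k t ^ 2) =
      (Icc (-(1 / (2 * (k : ℝ)))) (1 / (2 * (k : ℝ)))).indicator
        fun t => Real.cos ((k : ℝ) * π * t) ^ 2 := by
  have hk0 : (0 : ℝ) < k := by exact_mod_cast hk
  have hw0 : (0 : ℝ) < 1 / (2 * k) := by positivity
  ext t
  by_cases h : t ∈ Icc (-(1 / (2 * (k : ℝ)))) (1 / (2 * (k : ℝ)))
  · rw [indicator_of_mem h, hfun, if_neg (not_lt.mpr h.1), if_pos h.2, Real.cos_sq']
  · rw [indicator_of_notMem h, hfun]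
    split_ifs with h1 h2
    · norm_num
    · exact absurd ⟨not_lt.mp h1, h2⟩ h
    · norm_num

theorem integrable_one_sub_hfun_sq {k : ℕ} (hk : 1 ≤ k) :
    Integrable fun t => 1 - hfun k t ^ 2 := by
  rw [one_sub_hfun_sq_eq hk]
  exact ((by fun_prop : Continuous fun t : ℝ => Real.cos ((k : ℝ) * π * t) ^ 2)
    |>.continuousOn.integrableOn_Icc).integrable_indicator measurableSet_Icc

theorem integral_one_sub_hfun_sq {k : ℕ} (hk : 1 ≤ k) :
    ∫ t, (1 - hfun k t ^ 2) = 1 / (2 * (k : ℝ)) := by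
  have hk0 : (0 : ℝ) < k := by exact_mod_cast hk
  have hw0 : (0 : ℝ) < 1 / (2 * k) := by positivity
  have hkp : (k : ℝ) * π ≠ 0 := by have := Real.pi_pos; positivity
  have hw : (k : ℝ) * π * (1 / (2 * k)) = π / 2 := by field_simp
  rw [one_sub_hfun_sq_eq hk, integral_indicator measurableSet_Icc, integral_Icc_eq_integral_Ioc,
    ← intervalIntegral.integral_of_le (by linarith),
    intervalIntegral.integral_comp_mul_left (fun t => Real.cos t ^ 2) hkp, mul_neg, hw,
    integral_cos_sq]
  simp
  field_simp

/-- For ordered points, those to the left of `x` are the first ones. -/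
theorem lt_iff_lt_card_filter {k : ℕ} {b : ℕ → ℝ} (hb : ∀ i j, i ≤ j → j < k → b i ≤ b j)
    (x : ℝ) {i : ℕ} (hi : i < k) :
    b i < x ↔ i < ((Finset.range k).filter fun i => b i < x).card := by
  constructor
  · intro h
    have : Finset.range (i + 1) ⊆ (Finset.range k).filter fun i => b i < x := by
      intro j hj
      have hj' : j ≤ i := Nat.lt_succ_iff.mp (Finset.mem_range.mp hj)
      exact Finset.mem_filter.mpr
        ⟨Finset.mem_range.mpr (by omega), (hb j i hj' hi).trans_lt h⟩
    simpa using Finset.card_le_card this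
  · contrapose!
    intro h
    have : ((Finset.range k).filter fun i => b i < x) ⊆ Finset.range i := by
      intro j hj
      obtain ⟨hj1, hj2⟩ := Finset.mem_filter.mp hj
      by_contra hji
      have := hb i j (by simpa using hji) (Finset.mem_range.mp hj1)
      linarith
    simpa using Finset.card_le_card this

theorem gP_sq (k : ℕ) (b : ℕ → ℝ) (x : ℝ) :
    gP k b x ^ 2 =
      (min |hfun k (x - b ((((Finset.range k).filter fun i => b i < x).card) - 1))|
        |hfun k (x - b (Nat.min (((Finset.range k).filter fun i => b i < x).card) (k - 1)))|)
          ^ 2 := by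
  rw [gP, mul_pow, ← pow_mul, mul_comm _ 2, pow_mul]
  norm_num

theorem exists_gP_sq_eq {k : ℕ} (hk : 1 ≤ k) (b : ℕ → ℝ) (x : ℝ) :
    ∃ j < k, gP k b x ^ 2 = hfun k (x - b j) ^ 2 := by
  have hc : ((Finset.range k).filter fun i => b i < x).card ≤ k := by
    simpa using Finset.card_filter_le (Finset.range k) fun i => b i < x
  rw [gP_sq]
  rcases min_choice
    |hfun k (x - b ((((Finset.range k).filter fun i => b i < x).card) - 1))|
    |hfun k (x - b (Nat.min (((Finset.range k).filter fun i => b i < x).card) (k - 1)))|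
    with h | h
  · refine ⟨_, ?_, by rw [h, sq_abs]⟩
    omega
  · refine ⟨_, ?_, by rw [h, sq_abs]⟩
    exact (Nat.min_le_right _ _).trans_lt (by omega)

theorem gP_sq_le {k : ℕ} (hk : 1 ≤ k) {b : ℕ → ℝ} (hb : ∀ i j, i ≤ j → j < k → b i ≤ b j)
    (x : ℝ) {j : ℕ} (hj : j < k) : gP k b x ^ 2 ≤ hfun k (x - b j) ^ 2 := by
  rw [gP_sq, ← sq_abs (hfun k (x - b j))]
  have hiff := fun i (hi : i < k) => lt_iff_lt_card_filter hb x hi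
  have hc : ((Finset.range k).filter fun i => b i < x).card ≤ k := by
    simpa using Finset.card_filter_le (Finset.range k) fun i => b i < x
  generalize ((Finset.range k).filter fun i => b i < x).card = c at hiff hc
  refine pow_le_pow_left₀ (le_min (abs_nonneg _) (abs_nonneg _)) ?_ 2
  by_cases hjc : j < c
  · refine (min_le_left _ _).trans (abs_hfun_mono hk ?_)
    have h1 := (hiff (c - 1) (by omega)).mpr (by omega)
    have h2 := hb j (c - 1) (by omega) (by omega)
    rw [abs_of_nonneg (by linarith), abs_of_nonneg (by linarith)]
    linarith
  · refine (min_le_right _ _).trans (abs_hfun_mono hk ?_)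
    have hm : Nat.min c (k - 1) = c := Nat.min_eq_left (by omega)
    rw [hm]
    have h1 := not_lt.mp (mt (hiff c (by omega)).mp (lt_irrefl c))
    have h2 := hb c j (by omega) hj
    rw [abs_of_nonpos (by linarith), abs_of_nonpos (by linarith)]
    linarith

theorem gP_sq_le_one {k : ℕ} (hk : 1 ≤ k) (b : ℕ → ℝ) (x : ℝ) : gP k b x ^ 2 ≤ 1 := by
  obtain ⟨j, -, h⟩ := exists_gP_sq_eq hk b x
  rw [h, sq_le_one_iff_abs_le_one]
  exact abs_hfun_le_one hk _

theorem measurable_gP_sq {k : ℕ} (hk : 1 ≤ k) {b : ℕ → ℝ}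
    (hb : ∀ i j, i ≤ j → j < k → b i ≤ b j) : Measurable fun x => gP k b x ^ 2 := by
  have hne : (Finset.range k).Nonempty := Finset.nonempty_range_iff.mpr (by omega)
  have : (fun x => gP k b x ^ 2) =
      (Finset.range k).inf' hne fun j x => hfun k (x - b j) ^ 2 := by
    ext x
    rw [Finset.inf'_apply]
    refine le_antisymm (Finset.le_inf' _ _ fun j hj => gP_sq_le hk hb x (Finset.mem_range.mp hj)) ?_
    obtain ⟨j, hj, h⟩ := exists_gP_sq_eq hk b x
    rw [h]
    exact Finset.inf'_le (fun j => hfun k (x - b j) ^ 2) (Finset.mem_range.mpr hj)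
  rw [this]
  refine Finset.inf'_induction hne _ (fun f hf g hg => hf.inf hg) fun j _ => ?_
  exact ((measurable_hfun k).comp (measurable_id.sub_const _)).pow_const 2

/-- Almost everywhere, `g_P'² ≤ k²π²(1 - g_P²)`: near `x`, the function `g_P²` lies below `h_j²`
for some `j`, with equality at `x`. -/
theorem deriv_gP_sq_le {k : ℕ} (hk : 1 ≤ k) {b : ℕ → ℝ}
    (hb : ∀ i j, i ≤ j → j < k → b i ≤ b j) :
    ∀ᵐ x, deriv (gP k b) x ^ 2 ≤ π ^ 2 * (k : ℝ) ^ 2 * (1 - gP k b x ^ 2) := by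
  have hae : ∀ᵐ x : ℝ, ∀ j : ℕ, x ≠ b j ∧ x ≠ -(1 / (2 * (k : ℝ))) + b j ∧
      x ≠ 1 / (2 * (k : ℝ)) + b j :=
    ae_all_iff.mpr fun j => (Measure.ae_ne volume _).and
      ((Measure.ae_ne volume _).and (Measure.ae_ne volume _))
  filter_upwards [hae] with x hx
  have hnn : 0 ≤ π ^ 2 * (k : ℝ) ^ 2 * (1 - gP k b x ^ 2) :=
    mul_nonneg (by positivity) (sub_nonneg.mpr (gP_sq_le_one hk b x))
  by_cases hd : DifferentiableAt ℝ (gP k b) x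
  swap
  · rw [deriv_zero_of_not_differentiableAt hd]
    simpa using hnn
  obtain ⟨j, hj, hjx⟩ := exists_gP_sq_eq hk b x
  obtain ⟨hx0, hx1, hx2⟩ := hx j
  obtain ⟨d, hd1, hd2⟩ := exists_hasDerivAt_hfun hk (t := x - b j)
    (fun h => hx1 (by linarith)) (fun h => hx2 (by linarith))
  have hh : HasDerivAt (fun y => hfun k (y - b j)) d x := hd1.comp_sub_const x (b j)
  have hmax : IsLocalMax (fun y => gP k b y ^ 2 - hfun k (y - b j) ^ 2) x := by
    refine Filter.Eventually.of_forall fun y => ?_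
    have := gP_sq_le hk hb y hj
    simp only [hjx]
    linarith
  have h0 := hmax.hasDerivAt_eq_zero ((hd.hasDerivAt.pow 2).sub (hh.pow 2))
  have hne : hfun k (x - b j) ≠ 0 := hfun_ne_zero hk (sub_ne_zero.mpr hx0)
  have h1 : gP k b x * deriv (gP k b) x = hfun k (x - b j) * d := by
    norm_num at h0
    linarith
  have h2 : hfun k (x - b j) ^ 2 * deriv (gP k b) x ^ 2 = hfun k (x - b j) ^ 2 * d ^ 2 := by
    rw [← hjx, ← mul_pow, h1, hjx, ← mul_pow]
  rw [mul_left_cancel₀ (pow_ne_zero 2 hne) h2, hd2, hjx]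

theorem one_sub_gP_sq_le {k : ℕ} (hk : 1 ≤ k) (b : ℕ → ℝ) (x : ℝ) :
    1 - gP k b x ^ 2 ≤ ∑ j ∈ Finset.range k, (1 - hfun k (x - b j) ^ 2) := by
  obtain ⟨j, hj, h⟩ := exists_gP_sq_eq hk b x
  rw [h]
  refine Finset.single_le_sum (f := fun j => 1 - hfun k (x - b j) ^ 2) (fun i _ => ?_)
    (Finset.mem_range.mpr hj)
  exact sub_nonneg.mpr ((sq_le_one_iff_abs_le_one _).mpr (abs_hfun_le_one hk _))

theorem rayleigh_gP_le {s : Set ℝ} (hs : MeasurableSet s) {ρ : ℝ → ℝ}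
    (hρ : ∀ x ∈ s, 0 ≤ ρ x ∧ ρ x ≤ 1) (hmass : (∫ x in s, ρ x) = 1)
    {k : ℕ} (hk : 1 ≤ k) {b : ℕ → ℝ} (hb : ∀ i j, i ≤ j → j < k → b i ≤ b j) :
    (∫ x in s, ρ x * (deriv (gP k b) x) ^ 2) / (∫ x in s, ρ x * (gP k b x) ^ 2) ≤
      π ^ 2 * (k : ℝ) ^ 2 := by
  have hk0 : (0 : ℝ) < k := by exact_mod_cast hk
  have hi : Integrable ρ (volume.restrict s) := by
    by_contra h
    rw [integral_undef h] at hmass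
    exact zero_ne_one hmass
  have hig : Integrable (fun x => ρ x * gP k b x ^ 2) (volume.restrict s) := by
    refine hi.mul_bdd (c := 1) (measurable_gP_sq hk hb).aestronglyMeasurable
      (Filter.Eventually.of_forall fun x => ?_)
    rw [Real.norm_of_nonneg (sq_nonneg _)]
    exact gP_sq_le_one hk b x
  have hid : Integrable (fun x => ρ x * (1 - gP k b x ^ 2)) (volume.restrict s) := by
    simp_rw [mul_sub, mul_one]
    exact hi.sub hig
  have hsum : Integrable fun x => ∑ j ∈ Finset.range k, (1 - hfun k (x - b j) ^ 2) :=
    integrable_finsetSum _ fun j _ => (integrable_one_sub_hfun_sq hk).comp_sub_right (b j)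
  have hD : (∫ x in s, ρ x * (1 - gP k b x ^ 2)) ≤ 1 / 2 := by
    calc (∫ x in s, ρ x * (1 - gP k b x ^ 2))
        ≤ ∫ x in s, ∑ j ∈ Finset.range k, (1 - hfun k (x - b j) ^ 2) := by
          refine setIntegral_mono_on hid hsum.integrableOn hs fun x hx => ?_
          have h1 := sub_nonneg.mpr (gP_sq_le_one hk b x)
          exact (mul_le_of_le_one_left h1 (hρ x hx).2).trans (one_sub_gP_sq_le hk b x)
      _ ≤ ∫ x, ∑ j ∈ Finset.range k, (1 - hfun k (x - b j) ^ 2) :=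
          setIntegral_le_integral hsum (Filter.Eventually.of_forall fun x =>
            (sub_nonneg.mpr (gP_sq_le_one hk b x)).trans (one_sub_gP_sq_le hk b x))
      _ = 1 / 2 := by
          rw [integral_finsetSum _ fun j _ =>
            (integrable_one_sub_hfun_sq hk).comp_sub_right (b j)]
          simp_rw [integral_sub_right_eq_self (fun t => 1 - hfun k t ^ 2),
            integral_one_sub_hfun_sq hk]
          rw [Finset.sum_const, Finset.card_range, nsmul_eq_mul]
          field_simp
  have hden : (∫ x in s, ρ x * gP k b x ^ 2) = 1 - ∫ x in s, ρ x * (1 - gP k b x ^ 2) := by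
    simp_rw [mul_sub, mul_one]
    rw [integral_sub hi hig, hmass]
    ring
  have hnum : (∫ x in s, ρ x * deriv (gP k b) x ^ 2) ≤
      π ^ 2 * (k : ℝ) ^ 2 * ∫ x in s, ρ x * (1 - gP k b x ^ 2) := by
    rw [← integral_const_mul]
    refine integral_mono_of_nonneg ?_ (hid.const_mul _) ?_
    · filter_upwards [ae_restrict_mem hs] with x hx using mul_nonneg (hρ x hx).1 (sq_nonneg _)
    · filter_upwards [ae_restrict_mem hs, ae_restrict_of_ae (deriv_gP_sq_le hk hb)] with x hx h
      calc ρ x * deriv (gP k b) x ^ 2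
          ≤ ρ x * (π ^ 2 * (k : ℝ) ^ 2 * (1 - gP k b x ^ 2)) :=
            mul_le_mul_of_nonneg_left h (hρ x hx).1
        _ = _ := by ring
  rw [hden, div_le_iff₀ (by linarith)]
  exact hnum.trans (mul_le_mul_of_nonneg_left (by linarith) (by positivity))

/-- A truncation of `cos` on `[0, π/2]`, continuous on `ℝ` and supported in that interval. -/
noncomputable def truncCos (η t : ℝ) : ℝ :=
  max 0 (min (Real.cos (max 0 (min t (π / 2)))) (t / η))

theorem continuous_truncCos (η : ℝ) : Continuous (truncCos η) := by
  unfold truncCos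
  fun_prop

theorem truncCos_nonneg (η t : ℝ) : 0 ≤ truncCos η t := le_max_left _ _

theorem truncCos_of_nonpos {η t : ℝ} (hη : 0 < η) (ht : t ≤ 0) : truncCos η t = 0 :=
  max_eq_left ((min_le_right _ _).trans (div_nonpos_of_nonpos_of_nonneg ht hη.le))

theorem truncCos_of_pi_div_two_le {η t : ℝ} (ht : π / 2 ≤ t) : truncCos η t = 0 := by
  have := Real.pi_pos
  rw [truncCos, min_eq_right ht, max_eq_right (by positivity : (0 : ℝ) ≤ π / 2),
    Real.cos_pi_div_two]
  exact max_eq_left (min_le_left _ _)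

theorem truncCos_le_cos {η t : ℝ} (h0 : 0 ≤ t) (ht : t ≤ π / 2) : truncCos η t ≤ Real.cos t := by
  rw [truncCos, min_eq_left ht, max_eq_right h0]
  exact max_le (Real.cos_nonneg_of_neg_pi_div_two_le_of_le (by linarith) ht) (min_le_left _ _)

theorem truncCos_eq_cos {η t : ℝ} (hη : 0 < η) (h0 : η ≤ t) (ht : t ≤ π / 2) :
    truncCos η t = Real.cos t := by
  have h1 : Real.cos t ≤ t / η := (Real.cos_le_one t).trans ((one_le_div hη).mpr h0)
  rw [truncCos, min_eq_left ht, max_eq_right (hη.le.trans h0), min_eq_left h1]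
  exact max_eq_right (Real.cos_nonneg_of_neg_pi_div_two_le_of_le (by linarith) ht)

/-- A `C¹` approximation of `sin` on `[0, π/2]`, constant on both sides of that interval. -/
noncomputable def smoothSin (η t : ℝ) : ℝ := ∫ s in (0 : ℝ)..t, truncCos η s

theorem hasDerivAt_smoothSin (η t : ℝ) : HasDerivAt (smoothSin η) (truncCos η t) t :=
  (continuous_truncCos η).integral_hasStrictDerivAt 0 t |>.hasDerivAt

theorem deriv_smoothSin (η : ℝ) : deriv (smoothSin η) = truncCos η :=
  funext fun t => (hasDerivAt_smoothSin η t).deriv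

theorem contDiff_smoothSin (η : ℝ) : ContDiff ℝ 1 (smoothSin η) :=
  contDiff_one_iff_deriv.mpr ⟨fun t => (hasDerivAt_smoothSin η t).differentiableAt,
    deriv_smoothSin η ▸ continuous_truncCos η⟩

theorem monotone_smoothSin (η : ℝ) : Monotone (smoothSin η) :=
  monotone_of_deriv_nonneg (fun t => (hasDerivAt_smoothSin η t).differentiableAt)
    fun t => deriv_smoothSin η ▸ truncCos_nonneg η t

theorem smoothSin_sub (η s t : ℝ) :
    smoothSin η t - smoothSin η s = ∫ x in s..t, truncCos η x :=
  intervalIntegral.integral_interval_sub_left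
    ((continuous_truncCos η).intervalIntegrable _ _) ((continuous_truncCos η).intervalIntegrable _ _)

theorem smoothSin_of_nonpos {η t : ℝ} (hη : 0 < η) (ht : t ≤ 0) : smoothSin η t = 0 := by
  rw [smoothSin, intervalIntegral.integral_congr (g := fun _ => 0)]
  · simp
  · intro s hs
    rw [uIcc_of_ge ht] at hs
    exact truncCos_of_nonpos hη hs.2

theorem smoothSin_of_pi_div_two_le {η t : ℝ} (ht : π / 2 ≤ t) :
    smoothSin η t = smoothSin η (π / 2) := by
  rw [← sub_eq_zero, smoothSin_sub, intervalIntegral.integral_congr (g := fun _ => 0)]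
  · simp
  · intro s hs
    rw [uIcc_of_le ht] at hs
    exact truncCos_of_pi_div_two_le hs.1

theorem smoothSin_nonneg {η : ℝ} (hη : 0 < η) (t : ℝ) : 0 ≤ smoothSin η t := by
  rw [← smoothSin_of_nonpos hη (min_le_right t 0)]
  exact monotone_smoothSin η (min_le_left _ _)

theorem smoothSin_le (η t : ℝ) : smoothSin η t ≤ smoothSin η (π / 2) := by
  rw [← smoothSin_of_pi_div_two_le (le_max_right t (π / 2))]
  exact monotone_smoothSin η (le_max_left _ _)

theorem sin_sub_le_smoothSin {η t : ℝ} (hη : 0 < η) (h0 : 0 ≤ t) (ht : t ≤ π / 2) :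
    Real.sin t - η ≤ smoothSin η t := by
  rcases le_total t η with h | h
  · linarith [smoothSin_nonneg hη t, Real.sin_le h0]
  · have h1 := smoothSin_sub η η t
    rw [intervalIntegral.integral_congr (g := Real.cos), integral_cos] at h1
    · linarith [smoothSin_nonneg hη η, Real.sin_le hη.le]
    · intro s hs
      rw [uIcc_of_le h] at hs
      exact truncCos_eq_cos hη hs.1 (hs.2.trans ht)

theorem integral_truncCos_sq_le (η : ℝ) : ∫ t in (0 : ℝ)..π / 2, truncCos η t ^ 2 ≤ π / 4 := by
  have hpi := Real.pi_pos
  have h : ∫ t in (0 : ℝ)..π / 2, Real.cos t ^ 2 = π / 4 := by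
    rw [integral_cos_sq]
    simp
    ring
  rw [← h]
  refine intervalIntegral.integral_mono_on (by positivity)
    (((continuous_truncCos η).pow 2).intervalIntegrable _ _)
    ((Real.continuous_cos.pow 2).intervalIntegrable _ _) fun t ht => ?_
  exact pow_le_pow_left₀ (truncCos_nonneg η t) (truncCos_le_cos ht.1 ht.2) 2

theorem le_integral_smoothSin_sq {η : ℝ} (hη : 0 < η) :
    π / 4 * (1 - 4 * η) ≤ ∫ t in (0 : ℝ)..π / 2, smoothSin η t ^ 2 := by
  have hpi := Real.pi_pos
  have h : ∫ t in (0 : ℝ)..π / 2, (Real.sin t ^ 2 - 2 * η) = π / 4 * (1 - 4 * η) := by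
    rw [intervalIntegral.integral_sub
      ((by fun_prop : Continuous fun t => Real.sin t ^ 2).intervalIntegrable _ _) (by simp),
      integral_sin_sq]
    simp
    ring
  rw [← h]
  refine intervalIntegral.integral_mono_on (by positivity)
    (((Real.continuous_sin.pow 2).sub continuous_const).intervalIntegrable _ _)
    (((contDiff_smoothSin η).continuous.pow 2).intervalIntegrable _ _) fun t ht => ?_
  have h1 := sin_sub_le_smoothSin hη ht.1 ht.2
  have h2 := smoothSin_nonneg hη t
  have h3 := Real.sin_le_one t
  have h4 := Real.sin_nonneg_of_nonneg_of_le_pi ht.1 (by linarith [ht.2])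
  rcases le_total η (Real.sin t) with h5 | h5 <;> nlinarith

/-- A `C¹` function rising from `0` to `1` on `[0, 1/(2k)]`, whose Rayleigh quotient on that
interval is arbitrarily close to the optimal value `π²k²`. -/
theorem exists_transition {k : ℕ} (hk : 1 ≤ k) {c : ℝ} (hc : π ^ 2 * (k : ℝ) ^ 2 < c) :
    ∃ S : ℝ → ℝ, ContDiff ℝ 1 S ∧ (∀ t ≤ 0, S t = 0) ∧ (∀ t, 1 / (2 * (k : ℝ)) ≤ t → S t = 1) ∧
      (∀ t, 0 ≤ S t ∧ S t ≤ 1) ∧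
      ∫ t in (0 : ℝ)..1 / (2 * (k : ℝ)), deriv S t ^ 2 ≤
        c * ∫ t in (0 : ℝ)..1 / (2 * (k : ℝ)), S t ^ 2 := by
  have hpi := Real.pi_pos
  have hk0 : (0 : ℝ) < k := by exact_mod_cast hk
  have hω : (0 : ℝ) < k * π := by positivity
  have hw : (k : ℝ) * π * (1 / (2 * k)) = π / 2 := by field_simp
  have hc0 : 0 < c := lt_trans (by positivity) hc
  obtain ⟨η, hη, hη1, hηc⟩ : ∃ η : ℝ, 0 < η ∧ η < 1 ∧ π ^ 2 * (k : ℝ) ^ 2 = c * (1 - 4 * η) := by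
    refine ⟨(c - π ^ 2 * (k : ℝ) ^ 2) / (4 * c), div_pos (by linarith) (by linarith), ?_, ?_⟩
    · rw [div_lt_one (by linarith)]
      have : 0 < π ^ 2 * (k : ℝ) ^ 2 := by positivity
      linarith
    · field_simp
      ring
  set C := smoothSin η (π / 2)
  have hC0 : 0 < C := by
    have := sin_sub_le_smoothSin hη (by positivity) (le_refl (π / 2))
    rw [Real.sin_pi_div_two] at this
    linarith
  have hderiv : ∀ t, HasDerivAt (fun t => C⁻¹ * smoothSin η (k * π * t))
      (C⁻¹ * (truncCos η (k * π * t) * (k * π))) t := fun t =>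
    (((hasDerivAt_smoothSin η (k * π * t)).comp t
      (by simpa using (hasDerivAt_id t).const_mul ((k : ℝ) * π)))).const_mul _
  refine ⟨fun t => C⁻¹ * smoothSin η (k * π * t), ?_, fun t ht => ?_, fun t ht => ?_,
    fun t => ⟨?_, ?_⟩, ?_⟩
  · exact contDiff_const.mul ((contDiff_smoothSin η).comp (contDiff_const.mul contDiff_id))
  · dsimp only
    rw [smoothSin_of_nonpos hη (mul_nonpos_of_nonneg_of_nonpos hω.le ht), mul_zero]
  · dsimp only
    rw [smoothSin_of_pi_div_two_le (hw ▸ mul_le_mul_of_nonneg_left ht hω.le),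
      inv_mul_cancel₀ hC0.ne']
  · exact mul_nonneg (inv_nonneg.mpr hC0.le) (smoothSin_nonneg hη _)
  · rw [inv_mul_le_iff₀ hC0, mul_one]
    exact smoothSin_le _ _
  · simp_rw [fun t => (hderiv t).deriv]
    rw [intervalIntegral.integral_comp_mul_left
        (fun t => (C⁻¹ * (truncCos η t * (k * π))) ^ 2) hω.ne',
      intervalIntegral.integral_comp_mul_left (fun t => (C⁻¹ * smoothSin η t) ^ 2) hω.ne',
      mul_zero, hw]
    simp_rw [mul_pow, intervalIntegral.integral_const_mul, intervalIntegral.integral_mul_const,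
      smul_eq_mul]
    have h1 := integral_truncCos_sq_le η
    have h2 := le_integral_smoothSin_sq hη
    have h3 : (∫ t in (0 : ℝ)..π / 2, truncCos η t ^ 2) * ((k : ℝ) ^ 2 * π ^ 2) ≤
        c * ∫ t in (0 : ℝ)..π / 2, smoothSin η t ^ 2 :=
      calc _ ≤ π / 4 * (π ^ 2 * (k : ℝ) ^ 2) := by
            rw [mul_comm (π ^ 2)]
            exact mul_le_mul_of_nonneg_right h1 (by positivity)
        _ = c * (π / 4 * (1 - 4 * η)) := by rw [hηc]; ring
        _ ≤ _ := mul_le_mul_of_nonneg_left h2 hc0.le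
    have h4 := mul_le_mul_of_nonneg_left h3
      (by positivity : 0 ≤ (k * π : ℝ)⁻¹ * C⁻¹ ^ 2)
    calc _ = (k * π : ℝ)⁻¹ * C⁻¹ ^ 2 *
          ((∫ t in (0 : ℝ)..π / 2, truncCos η t ^ 2) * ((k : ℝ) ^ 2 * π ^ 2)) := by ring
      _ ≤ _ := h4
      _ = _ := by ring

/-- Mass transplantation on an interval of mass `w` with density at most `1`: the Rayleigh quotient
of a transition function is at most the one for unit density on an interval of length `w`. -/
theorem integral_transition_le {S : ℝ → ℝ} (hS : ContDiff ℝ 1 S) {w c : ℝ} (hw : 0 ≤ w)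
    (hc : 0 ≤ c) (h1 : ∀ t, w ≤ t → S t = 1) (h01 : ∀ t, 0 ≤ S t ∧ S t ≤ 1)
    (hR : ∫ t in (0 : ℝ)..w, deriv S t ^ 2 ≤ c * ∫ t in (0 : ℝ)..w, S t ^ 2)
    {ρ : ℝ → ℝ} (hi : ∀ x y, IntervalIntegrable ρ volume x y) (hρ : ∀ x, ρ x ≤ 1)
    {y z : ℝ} (hyz : y + w ≤ z) (hmass : ∫ x in y..z, ρ x = w) :
    ∫ x in y..z, ρ x * deriv S (x - y) ^ 2 ≤ c * ∫ x in y..z, ρ x * S (x - y) ^ 2 := by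
  have hle : y ≤ z := by linarith
  have hS' : Continuous (deriv S) := hS.continuous_deriv le_rfl
  have hSc : Continuous S := hS.continuous
  have transplant : ∀ f : ℝ → ℝ, Continuous f → (∀ t, 0 ≤ f t) → (∀ t, w < t → f t = 0) →
      ∫ x in y..z, ρ x * f (x - y) ≤ ∫ t in (0 : ℝ)..w, f t := by
    intro f hf hf0 hfw
    have hfc : Continuous fun x => f (x - y) := by fun_prop
    calc ∫ x in y..z, ρ x * f (x - y) ≤ ∫ x in y..z, f (x - y) := by
          refine intervalIntegral.integral_mono_on hle
            ((hi y z).mul_continuousOn hfc.continuousOn) (hfc.intervalIntegrable _ _) fun x _ => ?_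
          exact mul_le_of_le_one_left (hf0 _) (hρ x)
      _ = ∫ t in (0 : ℝ)..(z - y), f t := by
          rw [intervalIntegral.integral_comp_sub_right, sub_self]
      _ = (∫ t in (0 : ℝ)..w, f t) + ∫ t in w..(z - y), f t :=
          (intervalIntegral.integral_add_adjacent_intervals (hf.intervalIntegrable _ _)
            (hf.intervalIntegrable _ _)).symm
      _ = ∫ t in (0 : ℝ)..w, f t := by
          rw [intervalIntegral.integral_of_le (by linarith : w ≤ z - y),
            setIntegral_congr_fun (g := fun _ => (0 : ℝ)) measurableSet_Ioc
              fun t ht => hfw t ht.1]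
          simp
  have hnum := transplant (fun t => deriv S t ^ 2) (hS'.pow 2) (fun t => sq_nonneg _) fun t ht => by
    have he : S =ᶠ[nhds t] fun _ => 1 := by
      filter_upwards [Ioi_mem_nhds ht] with s hs using h1 s (mem_Ioi.mp hs).le
    simp [he.deriv_eq]
  have hden := transplant (fun t => 1 - S t ^ 2) (continuous_const.sub (hSc.pow 2))
    (fun t => sub_nonneg.mpr (pow_le_one₀ (h01 t).1 (h01 t).2)) fun t ht => by simp [h1 t ht.le]
  have hSq : Continuous fun x => S (x - y) ^ 2 := by fun_prop
  simp_rw [mul_sub, mul_one] at hden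
  rw [intervalIntegral.integral_sub (hi y z) ((hi y z).mul_continuousOn hSq.continuousOn), hmass,
    intervalIntegral.integral_sub (by simp)
      ((by fun_prop : Continuous fun t => S t ^ 2).intervalIntegrable _ _)] at hden
  simp only [intervalIntegral.integral_const, sub_zero, smul_eq_mul, mul_one] at hden
  exact hnum.trans (hR.trans (mul_le_mul_of_nonneg_left (by linarith) hc))

/-- The reflected version of `integral_transition_le`. -/
theorem integral_transition_le' {S : ℝ → ℝ} (hS : ContDiff ℝ 1 S) {w c : ℝ} (hw : 0 ≤ w)
    (hc : 0 ≤ c) (h1 : ∀ t, w ≤ t → S t = 1) (h01 : ∀ t, 0 ≤ S t ∧ S t ≤ 1)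
    (hR : ∫ t in (0 : ℝ)..w, deriv S t ^ 2 ≤ c * ∫ t in (0 : ℝ)..w, S t ^ 2)
    {ρ : ℝ → ℝ} (hi : ∀ x y, IntervalIntegrable ρ volume x y) (hρ : ∀ x, ρ x ≤ 1)
    {y z : ℝ} (hyz : y + w ≤ z) (hmass : ∫ x in y..z, ρ x = w) :
    ∫ x in y..z, ρ x * deriv S (z - x) ^ 2 ≤ c * ∫ x in y..z, ρ x * S (z - x) ^ 2 := by
  have h := integral_transition_le (ρ := fun x => ρ (-x)) (y := -z) (z := -y) hS hw hc h1 h01 hR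
    (fun x y => by simpa using (IntervalIntegrable.iff_comp_neg (by simp)).mp (hi (-x) (-y)))
    (fun x => hρ _) (by linarith)
    (by simpa [intervalIntegral.integral_comp_neg] using hmass)
  have e1 := intervalIntegral.integral_comp_neg (a := -z) (b := -y)
    fun x => ρ x * deriv S (z - x) ^ 2
  have e2 := intervalIntegral.integral_comp_neg (a := -z) (b := -y) fun x => ρ x * S (z - x) ^ 2
  simp only [neg_neg, sub_neg_eq_add, add_comm z] at h e1 e2
  rwa [e1, e2] at h

/-- Points cutting `(0, a)` into `2k` intervals of equal mass. -/
theorem exists_equal_mass_points {ρ : ℝ → ℝ} {δ a : ℝ} (hδ : 0 < δ)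
    (hi : ∀ x y, IntervalIntegrable ρ volume x y) (hρ : ∀ x, δ ≤ ρ x ∧ ρ x ≤ 1)
    (hmass : ∫ x in (0 : ℝ)..a, ρ x = 1) {k : ℕ} (hk : 1 ≤ k) :
    ∃ y : ℕ → ℝ, y 1 = 0 ∧ y (2 * k + 1) = a ∧ (∀ i, y i + 1 / (2 * (k : ℝ)) ≤ y (i + 1)) ∧
      ∀ i, ∫ x in y i..y (i + 1), ρ x = 1 / (2 * (k : ℝ)) := by
  have hk0 : (0 : ℝ) < k := by exact_mod_cast hk
  set M : ℝ → ℝ := fun x => ∫ t in (0 : ℝ)..x, ρ t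
  have hsub : ∀ x y, M y - M x = ∫ t in x..y, ρ t := fun x y =>
    intervalIntegral.integral_interval_sub_left (hi _ _) (hi _ _)
  have hlow : ∀ x y, x ≤ y → δ * (y - x) ≤ M y - M x := fun x y hxy => by
    have := intervalIntegral.integral_mono_on hxy (by simp) (hi x y) fun t _ => (hρ t).1
    rw [hsub]
    simpa [mul_comm] using this
  have hupp : ∀ x y, x ≤ y → M y - M x ≤ y - x := fun x y hxy => by
    have := intervalIntegral.integral_mono_on hxy (hi x y) (by simp) fun t _ => (hρ t).2
    rw [hsub]
    simpa using this
  have hM0 : M 0 = 0 := intervalIntegral.integral_same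
  have hmono : StrictMono M := fun x y hxy => by
    have := hlow x y hxy.le
    nlinarith [mul_pos hδ (sub_pos.mpr hxy)]
  have hcont : Continuous M := intervalIntegral.continuous_primitive hi 0
  have hsurj : Function.Surjective M := by
    refine hcont.surjective ?_ ?_
    · refine Filter.tendsto_atTop_mono' _ ?_ (Filter.tendsto_id.const_mul_atTop hδ)
      filter_upwards [Filter.eventually_ge_atTop 0] with x hx
      simpa [hM0] using hlow 0 x hx
    · refine Filter.tendsto_atBot_mono' _ ?_ (Filter.tendsto_id.const_mul_atBot hδ)
      filter_upwards [Filter.eventually_le_atBot 0] with x hx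
      have := hlow x 0 hx
      simp only [hM0, id] at this ⊢
      linarith
  choose y hy using fun i : ℕ => hsurj (((i : ℝ) - 1) / (2 * k))
  have hstep : ∀ i, M (y (i + 1)) - M (y i) = 1 / (2 * (k : ℝ)) := fun i => by
    rw [hy, hy]
    push_cast
    ring
  refine ⟨y, hmono.injective ?_, hmono.injective ?_, fun i => ?_, fun i => ?_⟩
  · rw [hy, hM0]
    simp
  · rw [hy]
    refine Eq.trans ?_ hmass.symm
    push_cast
    field_simp
    ring
  · have hle : y i ≤ y (i + 1) := by
      rw [← hmono.le_iff_le, ← sub_nonneg, hstep]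
      positivity
    linarith [hupp _ _ hle, hstep i]
  · rw [← hsub, hstep]

/-- The trial function equal to `α j` in the middle of the `j`-th cell `[y (2j), y (2j+2)]`,
going down to zero at the ends of the cells through the transition function `S`. -/
noncomputable def cellSum (S : ℝ → ℝ) (y : ℕ → ℝ) (n : ℕ) : (Fin n → ℝ) →ₗ[ℝ] (ℝ → ℝ) :=
  Fintype.linearCombination ℝ
    fun (j : Fin n) x => S (x - y (2 * j)) * S (y (2 * j + 2) - x)

theorem cellSum_apply (S : ℝ → ℝ) (y : ℕ → ℝ) (n : ℕ) (α : Fin n → ℝ) :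
    cellSum S y n α = fun x => ∑ j, α j * (S (x - y (2 * j)) * S (y (2 * j + 2) - x)) := by
  ext x
  simp [cellSum, Fintype.linearCombination_apply]

theorem contDiff_cellSum {S : ℝ → ℝ} (hS : ContDiff ℝ 1 S) (y : ℕ → ℝ) (n : ℕ) (α : Fin n → ℝ) :
    ContDiff ℝ 1 (cellSum S y n α) := by
  rw [cellSum_apply]
  fun_prop

theorem cellSum_eq_single {S : ℝ → ℝ} (h0 : ∀ t ≤ 0, S t = 0) {y : ℕ → ℝ} (hy : Monotone y)
    {n : ℕ} (α : Fin n → ℝ) (j : Fin n) {x : ℝ} (hx : y (2 * j) ≤ x) (hx' : x ≤ y (2 * j + 2)) :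
    cellSum S y n α x = α j * (S (x - y (2 * j)) * S (y (2 * j + 2) - x)) := by
  rw [cellSum_apply]
  refine Finset.sum_eq_single j (fun i _ hij => ?_) (by simp)
  rcases lt_or_gt_of_ne (Fin.val_ne_of_ne hij) with h | h
  · have := hy (show 2 * (i : ℕ) + 2 ≤ 2 * j by omega)
    rw [h0 (y (2 * i + 2) - x) (by linarith)]
    ring
  · have := hy (show 2 * (j : ℕ) + 2 ≤ 2 * i by omega)
    rw [h0 (x - y (2 * i)) (by linarith)]
    ring

theorem cellSum_eq_left {S : ℝ → ℝ} (h0 : ∀ t ≤ 0, S t = 0) {w : ℝ} (hw : 0 ≤ w)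
    (h1 : ∀ t, w ≤ t → S t = 1) {y : ℕ → ℝ} (hgap : ∀ i, y i + w ≤ y (i + 1))
    {n : ℕ} (α : Fin n → ℝ) (j : Fin n) {x : ℝ} (hx : x ∈ Ioo (y (2 * j)) (y (2 * j + 1))) :
    cellSum S y n α x = α j * S (x - y (2 * j)) := by
  have hy : Monotone y := monotone_nat_of_le_succ fun i => by linarith [hgap i]
  have := hgap (2 * j + 1)
  rw [cellSum_eq_single h0 hy α j hx.1.le (by linarith [hx.2]), h1 (y (2 * j + 2) - x), mul_one]
  linarith [hx.2]

theorem cellSum_eq_right {S : ℝ → ℝ} (h0 : ∀ t ≤ 0, S t = 0) {w : ℝ} (hw : 0 ≤ w)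
    (h1 : ∀ t, w ≤ t → S t = 1) {y : ℕ → ℝ} (hgap : ∀ i, y i + w ≤ y (i + 1))
    {n : ℕ} (α : Fin n → ℝ) (j : Fin n) {x : ℝ} (hx : x ∈ Ioo (y (2 * j + 1)) (y (2 * j + 2))) :
    cellSum S y n α x = α j * S (y (2 * j + 2) - x) := by
  have hy : Monotone y := monotone_nat_of_le_succ fun i => by linarith [hgap i]
  have := hgap (2 * j)
  rw [cellSum_eq_single h0 hy α j (by linarith [hx.1]) hx.2.le, h1 (x - y (2 * j)), one_mul]
  linarith [hx.1]

/-- If `F = α S(φ)` on an interval, with `φ' = ±1`, then a bound for the Rayleigh quotient of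
`S(φ)` carries over to `F`. -/
theorem integral_deriv_sq_le_of_eqOn {F S φ ρ : ℝ → ℝ} {y z α c e : ℝ} (hyz : y ≤ z)
    (he : e ^ 2 = 1) (hφ : ∀ x, HasDerivAt φ e x) (hS : ContDiff ℝ 1 S)
    (hF : ∀ x ∈ Ioo y z, F x = α * S (φ x))
    (h : ∫ x in y..z, ρ x * deriv S (φ x) ^ 2 ≤ c * ∫ x in y..z, ρ x * S (φ x) ^ 2) :
    ∫ x in y..z, ρ x * deriv F x ^ 2 ≤ c * ∫ x in y..z, ρ x * F x ^ 2 := by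
  simp only [intervalIntegral.integral_of_le hyz, integral_Ioc_eq_integral_Ioo] at h ⊢
  have h1 : ∫ x in Ioo y z, ρ x * deriv F x ^ 2 =
      α ^ 2 * ∫ x in Ioo y z, ρ x * deriv S (φ x) ^ 2 := by
    rw [← integral_const_mul]
    refine setIntegral_congr_fun measurableSet_Ioo fun x hx => ?_
    have hFx : F =ᶠ[nhds x] fun x => α * S (φ x) := by
      filter_upwards [Ioo_mem_nhds hx.1 hx.2] with x hx using hF x hx
    have hd := (((hS.differentiable one_ne_zero) (φ x)).hasDerivAt.comp x (hφ x)).const_mul α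
    simp only [hFx.deriv_eq, Function.comp_def] at hd ⊢
    rw [hd.deriv, mul_pow, mul_pow, he]
    ring
  have h2 : ∫ x in Ioo y z, ρ x * F x ^ 2 = α ^ 2 * ∫ x in Ioo y z, ρ x * S (φ x) ^ 2 := by
    rw [← integral_const_mul]
    refine setIntegral_congr_fun measurableSet_Ioo fun x hx => ?_
    simp only [hF x hx]
    ring
  rw [h1, h2]
  calc _ ≤ α ^ 2 * (c * ∫ x in Ioo y z, ρ x * S (φ x) ^ 2) :=
        mul_le_mul_of_nonneg_left h (sq_nonneg α)
    _ = _ := by ring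

theorem muSL_le {a δ : ℝ} (ha : 0 < a) (hδ : 0 < δ) {ρ : ℝ → ℝ} (hρm : Measurable ρ)
    (hρ : ∀ x ∈ Icc 0 a, δ ≤ ρ x ∧ ρ x ≤ 1) (hmass : (∫ x in Ioo 0 a, ρ x) = 1)
    {k : ℕ} (hk : 1 ≤ k) {c : ℝ} (hc : π ^ 2 * (k : ℝ) ^ 2 < c) :
    muSL k 0 a ρ ρ ≤ ENNReal.ofReal c := by
  have hk0 : (0 : ℝ) < k := by exact_mod_cast hk
  have hw0 : (0 : ℝ) < 1 / (2 * k) := by positivity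
  have hc0 : 0 ≤ c := le_trans (by positivity) hc.le
  have hδ1 : δ ≤ 1 := (hρ 0 ⟨le_rfl, ha.le⟩).1.trans (hρ 0 ⟨le_rfl, ha.le⟩).2
  set σ : ℝ → ℝ := fun x => max δ (min (ρ x) 1) with hσdef
  have hσ : ∀ x, δ ≤ σ x ∧ σ x ≤ 1 := fun x =>
    ⟨le_max_left _ _, max_le hδ1 (min_le_right _ _)⟩
  have hσm : Measurable σ := measurable_const.max (hρm.min measurable_const)
  have hσρ : ∀ x ∈ Ioo 0 a, ρ x = σ x := fun x hx => by
    obtain ⟨h1, h2⟩ := hρ x (Ioo_subset_Icc_self hx)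
    simp only [hσdef, min_eq_left h2, max_eq_right h1]
  have hi : ∀ x y, IntervalIntegrable σ volume x y := fun x y =>
    (intervalIntegrable_const (c := (1 : ℝ))).mono_fun hσm.aestronglyMeasurable
      (Filter.Eventually.of_forall fun t => by
        simp only [norm_one]
        rw [Real.norm_of_nonneg (hδ.le.trans (hσ t).1)]
        exact (hσ t).2)
  have hswap : ∀ f : ℝ → ℝ, ∫ x in Ioo 0 a, ρ x * f x = ∫ x in (0 : ℝ)..a, σ x * f x := fun f => by
    rw [intervalIntegral.integral_of_le ha.le, integral_Ioc_eq_integral_Ioo]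
    exact setIntegral_congr_fun measurableSet_Ioo fun x hx => by simp only [hσρ x hx]
  have hσmass : ∫ x in (0 : ℝ)..a, σ x = 1 := by
    simpa [hmass] using (hswap fun _ => 1).symm
  obtain ⟨y, hy1, hya, hgap, hymass⟩ := exists_equal_mass_points hδ hi hσ hσmass hk
  obtain ⟨S, hS, hS0, hS1, hS01, hSR⟩ := exists_transition hk hc
  have hy : Monotone y := monotone_nat_of_le_succ fun i => by linarith [hgap i]
  have hSc := hS.continuous
  obtain ⟨t, ht0, htw, ht⟩ : ∃ t, 0 < t ∧ t < 1 / (2 * (k : ℝ)) ∧ S t ≠ 0 := by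
    have hne : ∀ᶠ t in nhdsWithin (1 / (2 * (k : ℝ))) (Iio (1 / (2 * (k : ℝ)))), S t ≠ 0 :=
      (hSc.continuousAt.eventually_ne (by rw [hS1 _ le_rfl]; exact one_ne_zero)).filter_mono
        nhdsWithin_le_nhds
    obtain ⟨t, h, h'⟩ := (hne.and (Ioo_mem_nhdsLT hw0)).exists
    exact ⟨t, h'.1, h'.2, h⟩
  have hinj : Function.Injective (indicatorL (Ioo 0 a) ∘ₗ cellSum S y (k + 1)) := by
    refine (injective_iff_map_eq_zero _).mpr fun α hα => funext fun j => ?_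
    have hz : ∀ x ∈ Ioo 0 a, cellSum S y (k + 1) α x = 0 := fun x hx => by
      have := congrFun hα x
      simpa [indicatorL, hx.1, hx.2] using this
    rcases Nat.lt_or_ge j k with hj | hj
    · have h1 := hgap (2 * j + 1)
      have h2 := hy (show 1 ≤ 2 * (j : ℕ) + 1 by omega)
      have h3 := hy (show 2 * (j : ℕ) + 2 ≤ 2 * k + 1 by omega)
      have h4 := hz (y (2 * j + 2) - t) ⟨by linarith, by linarith⟩
      rw [cellSum_eq_right hS0 hw0.le hS1 hgap α j ⟨by linarith, by linarith⟩,
        _root_.sub_sub_cancel] at h4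
      exact (mul_eq_zero.mp h4).resolve_right ht
    · have hjk : (j : ℕ) = k := by omega
      have h1 := hgap (2 * j)
      have h2 := hy (show 1 ≤ 2 * (j : ℕ) by omega)
      have h3 := hy (show 2 * (j : ℕ) + 1 ≤ 2 * k + 1 by omega)
      have h4 := hz (y (2 * j) + t) ⟨by linarith, by linarith⟩
      rw [cellSum_eq_left hS0 hw0.le hS1 hgap α j ⟨by linarith, by linarith⟩,
        add_sub_cancel_left] at h4
      exact (mul_eq_zero.mp h4).resolve_right ht
  refine (iInf_le _ ⟨LinearMap.range (cellSum S y (k + 1)), ?_, ?_⟩).trans (iSup_le ?_)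
  rotate_left
  · rintro _ ⟨α, rfl⟩
    exact contDiff_cellSum hS y _ α
  · rw [← LinearMap.range_comp, LinearMap.finrank_range_of_inj hinj]
    simp
  · rintro ⟨_, ⟨α, rfl⟩, -⟩
    refine ENNReal.ofReal_le_ofReal (div_le_of_le_mul₀ ?_ hc0 ?_)
    · refine setIntegral_nonneg measurableSet_Ioo fun x hx => mul_nonneg ?_ (sq_nonneg _)
      exact hδ.le.trans (hρ x (Ioo_subset_Icc_self hx)).1
    simp only [hswap]
    set F := cellSum S y (k + 1) α
    have hF : ContDiff ℝ 1 F := contDiff_cellSum hS y _ α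
    have hF' : Continuous (deriv F) := hF.continuous_deriv le_rfl
    have hsplit : ∀ f : ℝ → ℝ, Continuous f → ∫ x in (0 : ℝ)..a, σ x * f x =
        ∑ i ∈ Finset.Ico 1 (2 * k + 1), ∫ x in y i..y (i + 1), σ x * f x := fun f hf => by
      rw [← hy1, ← hya]
      exact (intervalIntegral.sum_integral_adjacent_intervals_Ico (by omega) fun i _ =>
        (hi _ _).mul_continuousOn hf.continuousOn).symm
    rw [hsplit (fun x => deriv F x ^ 2) (hF'.pow 2), hsplit (fun x => F x ^ 2) (hF.continuous.pow 2),
      Finset.mul_sum]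
    refine Finset.sum_le_sum fun i hi' => ?_
    obtain ⟨hi1, hi2⟩ := Finset.mem_Ico.mp hi'
    rcases Nat.even_or_odd' i with ⟨j, rfl | rfl⟩
    · exact integral_deriv_sq_le_of_eqOn (hy (Nat.le_succ _)) (one_pow 2)
        (fun x => (hasDerivAt_id x).sub_const (y (2 * j))) hS
        (fun x hx => cellSum_eq_left hS0 hw0.le hS1 hgap α ⟨j, by omega⟩ hx)
        (integral_transition_le hS hw0.le hc0 hS1 hS01 hSR hi (fun x => (hσ x).2) (hgap _)
          (hymass _))
    · exact integral_deriv_sq_le_of_eqOn (hy (Nat.le_succ _)) (by norm_num)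
        (fun x => (hasDerivAt_id x).const_sub (y (2 * j + 2))) hS
        (fun x hx => cellSum_eq_right hS0 hw0.le hS1 hgap α ⟨j, by omega⟩ hx)
        (integral_transition_le' hS hw0.le hc0 hS1 hS01 hSR hi (fun x => (hσ x).2) (hgap _)
          (hymass _))

/-- Validity of the test functions `g_P`: if `g_P` is `ρ`-orthogonal to the first `k`
Neumann eigenfunctions `u₀ = 1, u₁, …, u_{k-1}` of `-(ρu')' = μρu` on `(0,a)` (with
`ρ : [0,a] → [δ,1]` of unit mass), then its Rayleigh quotient is at most `π²k²`, and
consequently `μ_k(ρ) ≤ π²k²`. -/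
theorem stmt_7 (a δ : ℝ) (ha : 0 < a) (hδ : 0 < δ) (ρ : ℝ → ℝ) (hρm : Measurable ρ)
    (hρ : ∀ x ∈ Set.Icc 0 a, δ ≤ ρ x ∧ ρ x ≤ 1)
    (hmass : (∫ x in Set.Ioo 0 a, ρ x) = 1)
    (k : ℕ) (hk : 1 ≤ k) (b : ℕ → ℝ) (hb : ∀ i j, i ≤ j → j < k → b i ≤ b j)
    (u : ℕ → ℝ → ℝ) (hu0 : u 0 = fun _ => 1)
    (hureg : ∀ i < k, ContDiff ℝ 1 (u i))
    (hueig : ∀ i < k, (∀ x ∈ Set.Ioo 0 a,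
        HasDerivAt (fun y => ρ y * deriv (u i) y)
          (-((muSL i 0 a ρ ρ).toReal * ρ x * u i x)) x) ∧
      deriv (u i) 0 = 0 ∧ deriv (u i) a = 0)
    (horth : ∀ i < k, (∫ x in Set.Ioo 0 a, ρ x * gP k b x * u i x) = 0) :
    (∫ x in Set.Ioo 0 a, ρ x * (deriv (gP k b) x) ^ 2) /
      (∫ x in Set.Ioo 0 a, ρ x * (gP k b x) ^ 2) ≤ π ^ 2 * (k : ℝ) ^ 2 ∧
    muSL k 0 a ρ ρ ≤ ENNReal.ofReal (π ^ 2 * (k : ℝ) ^ 2) := by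
  refine ⟨rayleigh_gP_le measurableSet_Ioo (fun x hx => ?_) hmass hk hb, ?_⟩
  · obtain ⟨h1, h2⟩ := hρ x (Ioo_subset_Icc_self hx)
    exact ⟨hδ.le.trans h1, h2⟩
  · refine ge_of_tendsto ((ENNReal.continuous_ofReal.tendsto _).mono_left
      (nhdsWithin_le_nhds (s := Ioi (π ^ 2 * (k : ℝ) ^ 2)))) ?_
    filter_upwards [self_mem_nhdsWithin] with c hc using muSL_le ha hδ hρm hρ hmass hk hc
end
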